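/- arXiv:2010.03676 — 4 statements merged into one kernel-verified Lean document; each statement's English description precedes it below -/
import Mathlib

section
/- Let A be a group whose local rank equals a finite nonnegative integer r, and let ⟨t⟩ be an infinite cyclic group. Then the free product A ∗ ⟨t⟩ has local rank exactly r + 1. -/
/-- The rank of a subgroup, as an extended natural number: the minimal cardinality of a
finite generating set, or `⊤` if the subgroup is not finitely generated. -/
noncomputable def subgroupRank {Γ : Type*} [Group Γ] (H : Subgroup Γ) : ℕ∞ :=
  ⨅ (S : Finset Γ) (_ : Subgroup.closure (S : Set Γ) = H), (S.card : ℕ∞)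

/-- `A` has local rank at most `r` if every finitely generated subgroup of `A` is contained
in a subgroup of `A` of rank at most `r`. -/
def LocalRankLE {Γ : Type*} [Group Γ] (A : Subgroup Γ) (r : ℕ) : Prop :=
  ∀ B : Subgroup Γ, B ≤ A → B.FG →
    ∃ C : Subgroup Γ, C ≤ A ∧ B ≤ C ∧ subgroupRank C ≤ (r : ℕ∞)

/-- The local rank of a subgroup: the least `r` such that `LocalRankLE A r`, or `⊤` if
there is no such `r`. -/
noncomputable def localRank {Γ : Type*} [Group Γ] (A : Subgroup Γ) : ℕ∞ :=
  ⨅ (r : ℕ) (_ : LocalRankLE A r), (r : ℕ∞)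

/-- A group is `k`-free if every subgroup of rank at most `k` is free. -/
def KFree (Γ : Type*) [Group Γ] (k : ℕ) : Prop :=
  ∀ H : Subgroup Γ, subgroupRank H ≤ (k : ℕ∞) → IsFreeGroup H

/-- The index of freedom of `Γ`: the supremum of all `k` such that `Γ` is `k`-free. -/
noncomputable def iof (Γ : Type*) [Group Γ] : ℕ∞ :=
  ⨆ (k : ℕ) (_ : KFree Γ k), (k : ℕ∞)

/-- A subgroup `A` of `Γ` is strongly closable if `localRank A < iof Γ`. -/
def StronglyClosable {Γ : Type*} [Group Γ] (A : Subgroup Γ) : Prop :=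
  localRank A < iof Γ

/-- A subgroup `A` of `Γ` is closable if it has finite local rank and there is some `z ∈ Γ`
with `localRank ⟨A, z⟩ < iof Γ`. -/
def Closable {Γ : Type*} [Group Γ] (A : Subgroup Γ) : Prop :=
  localRank A < ⊤ ∧ ∃ z : Γ, localRank (A ⊔ Subgroup.closure {z}) < iof Γ

/-- An element `x` of `Γ` is `A`-admissible if `⟨A, x⟩` is strongly closable and
`localRank ⟨A, x⟩ ≤ localRank A`. -/
def Admissible {Γ : Type*} [Group Γ] (A : Subgroup Γ) (x : Γ) : Prop :=
  StronglyClosable (A ⊔ Subgroup.closure {x}) ∧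
    localRank (A ⊔ Subgroup.closure {x}) ≤ localRank A

/-- A sequence `x₁, …, x_m` is `A`-admissible if each `x_i` is `⟨A, x₁, …, x_{i-1}⟩`-admissible. -/
def AdmissibleSeq {Γ : Type*} [Group Γ] : Subgroup Γ → List Γ → Prop
  | _, [] => True
  | A, x :: xs => Admissible A x ∧ AdmissibleSeq (A ⊔ Subgroup.closure {x}) xs

/-- `clo A` is the set of all `x ∈ Γ` which occur as the last term of an `A`-admissible
sequence. -/
def clo {Γ : Type*} [Group Γ] (A : Subgroup Γ) : Set Γ :=
  { x | ∃ l : List Γ, AdmissibleSeq A (l ++ [x]) }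

/-- The homomorphism `ι_{A,x}` from the free product `A ∗ ⟨t⟩` to `Γ` restricting to the
inclusion on `A` and sending `t` to `x`. -/
noncomputable def iotaAX {Γ : Type*} [Group Γ] (A : Subgroup Γ) (x : Γ) :
    Monoid.Coprod (↥A) (Multiplicative ℤ) →* Γ :=
  Monoid.Coprod.lift A.subtype (zpowersHom Γ x)

/-- Elements `g 0, …, g (m-1)` of `Γ` are independent if they freely generate a free subgroup,
i.e. the induced homomorphism from the free group on `m` generators is injective. -/
def Independent {Γ : Type*} [Group Γ] {m : ℕ} (g : Fin m → Γ) : Prop :=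
  Function.Injective (FreeGroup.lift g : FreeGroup (Fin m) →* Γ)

section
open Monoid
variable {A : Type*} [Group A]

theorem perm_ext {X : Type*} (R : X → X → Prop) (h1 : ∀ x y z, R x y → R x z → y = z)
    (h2 : ∀ x y z, R x z → R y z → x = y) : ∃ T : Equiv.Perm (X × Bool),
    (∀ x y, R x y → T (x, false) = (y, false)) ∧
    (∀ x y, T (x, false) = (y, false) → R x y) := by
  classical
  let p : X × Bool → X × Bool := fun z =>
    if z.2 then (if h : ∃ y, R y z.1 then (h.choose, true) else (z.1, false))
    else (if h : ∃ y, R z.1 y then (h.choose, false) else (z.1, true))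
  let q : X × Bool → X × Bool := fun z =>
    if z.2 then (if h : ∃ y, R z.1 y then (h.choose, true) else (z.1, false))
    else (if h : ∃ y, R y z.1 then (h.choose, false) else (z.1, true))
  have e1 : ∀ x y (h : R x y) (h' : ∃ y, R x y), h'.choose = y :=
    fun x y h h' => h1 _ _ _ h'.choose_spec h
  have e2 : ∀ x y (h : R x y) (h' : ∃ x, R x y), h'.choose = x :=
    fun x y h h' => h2 _ _ _ h'.choose_spec h
  have pt1 : ∀ x y, R x y → p (y, true) = (x, true) := by
    intro x y h
    have h' : ∃ x, R x y := ⟨x, h⟩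
    simp only [p, if_true, dif_pos h', e2 x y h h']
  have pt2 : ∀ y, (¬ ∃ x, R x y) → p (y, true) = (y, false) := by
    intro y h; simp only [p, if_true, dif_neg h]
  have pf1 : ∀ x y, R x y → p (x, false) = (y, false) := by
    intro x y h
    have h' : ∃ y, R x y := ⟨y, h⟩
    simp [p, dif_pos h', e1 x y h h']
  have pf2 : ∀ x, (¬ ∃ y, R x y) → p (x, false) = (x, true) := by
    intro y h; simp only [p, dif_neg h]; simp
  have qt1 : ∀ x y, R x y → q (x, true) = (y, true) := by
    intro x y h
    have h' : ∃ y, R x y := ⟨y, h⟩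
    simp only [q, if_true, dif_pos h', e1 x y h h']
  have qt2 : ∀ x, (¬ ∃ y, R x y) → q (x, true) = (x, false) := by
    intro y h; simp only [q, if_true, dif_neg h]
  have qf1 : ∀ x y, R x y → q (y, false) = (x, false) := by
    intro x y h
    have h' : ∃ x, R x y := ⟨x, h⟩
    simp [q, dif_pos h', e2 x y h h']
  have qf2 : ∀ y, (¬ ∃ x, R x y) → q (y, false) = (y, true) := by
    intro y h; simp only [q, dif_neg h]; simp
  refine ⟨⟨p, q, ?_, ?_⟩, pf1, ?_⟩
  · rintro ⟨x, _ | _⟩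
    · by_cases h : ∃ y, R x y
      · obtain ⟨y, h⟩ := h
        rw [pf1 _ _ h, qf1 _ _ h]
      · rw [pf2 _ h, qt2 _ h]
    · by_cases h : ∃ y, R y x
      · obtain ⟨y, h⟩ := h
        rw [pt1 _ _ h, qt1 _ _ h]
      · rw [pt2 _ h, qf2 _ h]
  · rintro ⟨x, _ | _⟩
    · by_cases h : ∃ y, R y x
      · obtain ⟨y, h⟩ := h
        rw [qf1 _ _ h, pf1 _ _ h]
      · rw [qf2 _ h, pt2 _ h]
    · by_cases h : ∃ y, R x y
      · obtain ⟨y, h⟩ := h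
        rw [qt1 _ _ h, pt1 _ _ h]
      · rw [qt2 _ h, pf2 _ h]
  · intro x y h
    change p (x, false) = _ at h
    by_cases h' : ∃ y, R x y
    · obtain ⟨z, h'⟩ := h'
      rw [pf1 _ _ h'] at h
      simp at h
      exact h ▸ h'
    · rw [pf2 _ h'] at h
      simp at h

/-- graph data -/
structure GSt (A : Type*) where
  V : Type
  fin : Finite V
  K : Finset (V × A)
  E : Finset (V × A × A × V)

/-- the stable letter -/
def tt : Coprod A (Multiplicative ℤ) := Coprod.inr (Multiplicative.ofAdd 1)

inductive GSt.P (S : GSt A) : S.V → Coprod A (Multiplicative ℤ) → S.V → Prop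
  | one (u) : P S u 1 u
  | vtx (u a) (h : (u, a) ∈ S.K) : P S u (Coprod.inl a) u
  | edge (u a b v) (h : (u, a, b, v) ∈ S.E) : P S u (Coprod.inl a * tt * Coprod.inl b) v
  | mul (u g v h w) (h1 : P S u g v) (h2 : P S v h w) : P S u (g * h) w
  | inv (u g v) (h1 : P S u g v) : P S v g⁻¹ u

def GSt.stab (S : GSt A) (u : S.V) : Subgroup A := Subgroup.closure {a | (u, a) ∈ S.K}

def GSt.Conn (S : GSt A) : Prop := ∀ u v, ∃ g, S.P u g v

theorem GSt.P_stab (S : GSt A) (u : S.V) (a : A) (h : a ∈ S.stab u) : S.P u (Coprod.inl a) u := by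
  induction h using Subgroup.closure_induction with
  | mem x hx => exact .vtx _ _ hx
  | one => simpa using GSt.P.one u
  | mul x y _ _ h1 h2 => simpa using GSt.P.mul _ _ _ _ _ h1 h2
  | inv x _ h1 => simpa using GSt.P.inv _ _ _ h1

theorem GSt.P_map {S S' : GSt A} (f : S.V → S'.V) (h : S.V → A)
    (hK : ∀ u a, (u, a) ∈ S.K → S'.P (f u) (Coprod.inl ((h u)⁻¹ * a * h u)) (f u))
    (hE : ∀ u a b v, (u, a, b, v) ∈ S.E →
      S'.P (f u) (Coprod.inl ((h u)⁻¹ * a) * tt * Coprod.inl (b * h v)) (f v))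
    (u g v) (hp : S.P u g v) :
    S'.P (f u) ((Coprod.inl (h u))⁻¹ * g * Coprod.inl (h v)) (f v) := by
  induction hp with
  | one u => simpa using GSt.P.one (S := S') (f u)
  | vtx u a hh => simpa using hK u a hh
  | edge u a b v hh => simpa [mul_assoc] using hE u a b v hh
  | mul u g v k w _ _ h1 h2 => simpa [mul_assoc] using GSt.P.mul _ _ _ _ _ h1 h2
  | inv u g v _ h1 => simpa [mul_assoc] using GSt.P.inv _ _ _ h1

/-- the relation -/
def GSt.R (S : GSt A) (x y : Σ v, A ⧸ S.stab v) : Prop :=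
  ∃ u a b v, (u, a, b, v) ∈ S.E ∧ x = ⟨v, (b : A ⧸ S.stab v)⟩ ∧ y = ⟨u, ((a⁻¹ : A) : A ⧸ S.stab u)⟩

theorem GSt.folded (S : GSt A) (h1 : ∀ x y z, S.R x y → S.R x z → y = z)
    (h2 : ∀ x y z, S.R x z → S.R y z → x = y) :
    (∀ u a, S.P u (Coprod.inl a) u → a ∈ S.stab u) ∧
    (∀ u x, S.P u ((Coprod.inl x)⁻¹ * tt * Coprod.inl x) u → ∃ a b, (u, a, b, u) ∈ S.E) := by
  obtain ⟨T, hT1, hT2⟩ := perm_ext S.R h1 h2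
  let X := Σ v, A ⧸ S.stab v
  let act : A →* Equiv.Perm (X × Bool) := MonoidHom.mk'
    (fun a => Equiv.prodCongr (Equiv.sigmaCongrRight fun v => MulAction.toPerm a) (Equiv.refl _)) (by
      intro a b
      refine Equiv.ext ?_
      rintro ⟨⟨v, c⟩, i⟩
      change ((⟨v, (a * b) • c⟩ : X), i) = (⟨v, a • b • c⟩, i)
      rw [mul_smul])
  have hact : ∀ a v (c : A), act a (⟨v, (c : A ⧸ S.stab v)⟩, false)
    = (⟨v, ((a * c : A) : A ⧸ S.stab v)⟩, false) := fun _ _ _ => rfl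
  let φ : Coprod A (Multiplicative ℤ) →* Equiv.Perm (X × Bool) := Coprod.lift act (zpowersHom _ T)
  have hl : ∀ a, φ (Coprod.inl a) = act a := fun a => by simp [φ]
  have ht : φ tt = T := by simp [φ, tt]
  have key : ∀ u g v, S.P u g v → φ g (⟨v, ((1 : A) : A ⧸ S.stab v)⟩, false) =
      (⟨u, ((1 : A) : A ⧸ S.stab u)⟩, false) := by
    intro u g v h
    induction h with
    | one u => simp
    | vtx u a h =>
      rw [hl, hact]
      congr 2
      rw [QuotientGroup.eq]
      simpa using (show a ∈ S.stab u from Subgroup.subset_closure h)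
    | edge u a b v h =>
      rw [map_mul, map_mul, hl, hl, ht, Equiv.Perm.mul_apply, Equiv.Perm.mul_apply, hact, mul_one,
        hT1 _ _ ⟨u, a, b, v, h, rfl, rfl⟩, hact, mul_inv_cancel]
    | mul u g v k w _ _ h1 h2 => rw [map_mul, Equiv.Perm.mul_apply, h2, h1]
    | inv u g v _ h1 => rw [map_inv, Equiv.Perm.inv_eq_iff_eq, h1]
  constructor
  · intro u a h
    have := key _ _ _ h
    rw [hl, hact] at this
    have := eq_of_heq (Sigma.mk.inj (Prod.mk.inj this).1).2
    rw [QuotientGroup.eq] at this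
    simpa using this
  · intro u x h
    have := key _ _ _ h
    rw [map_mul, map_mul, hl, ht, ← map_inv, hl, Equiv.Perm.mul_apply, Equiv.Perm.mul_apply, hact,
      map_inv, Equiv.Perm.inv_eq_iff_eq, hact] at this
    obtain ⟨u', a, b, v, hE, e1, e2⟩ := hT2 _ _ this
    have e1 := congrArg Sigma.fst e1
    have e2 := congrArg Sigma.fst e2
    simp only at e1 e2
    subst e1 e2
    exact ⟨a, b, hE⟩

theorem GSt.card_le (S : GSt A) (hc : S.Conn) (u a b) (h : (u, a, b, u) ∈ S.E) :
    Nat.card S.V ≤ S.E.card := by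
  classical
  have := S.fin
  let G : SimpleGraph S.V := SimpleGraph.fromRel fun u v => ∃ a b, (u, a, b, v) ∈ S.E
  have hr : ∀ u g v, S.P u g v → G.Reachable u v := by
    intro u g v h
    induction h with
    | one u => rfl
    | vtx u a h => rfl
    | edge u a b v h =>
      by_cases e : u = v
      · rw [e]
      · exact SimpleGraph.Adj.reachable ((SimpleGraph.fromRel_adj _ _ _).2 ⟨e, Or.inl ⟨_, _, h⟩⟩)
    | mul u g v k w _ _ h1 h2 => exact h1.trans h2
    | inv u g v _ h1 => exact h1.symm
  have hG : G.Connected := by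
    have : Nonempty S.V := ⟨u⟩
    exact ⟨fun u v => by obtain ⟨g, hg⟩ := hc u v; exact hr _ _ _ hg⟩
  have h1 := hG.card_vert_le_card_edgeSet_add_one
  have h2 : G.edgeSet ⊆ ↑((S.E.erase (u, a, b, u)).image fun e => s(e.1, e.2.2.2)) := by
    intro e
    induction e with | h x y =>
    intro he
    rw [SimpleGraph.mem_edgeSet, SimpleGraph.fromRel_adj] at he
    simp only [Finset.coe_image, Set.mem_image, Finset.mem_coe, Finset.mem_erase]
    obtain ⟨hn, ⟨c, d, h'⟩ | ⟨c, d, h'⟩⟩ := he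
    · refine ⟨_, ⟨?_, h'⟩, rfl⟩
      rintro ⟨⟩; exact hn rfl
    · refine ⟨_, ⟨?_, h'⟩, Sym2.eq_swap⟩
      rintro ⟨⟩; exact hn rfl
  have h3 : Nat.card G.edgeSet ≤ (S.E.erase (u, a, b, u)).card := by
    rw [Nat.card_coe_set_eq]
    refine (Set.ncard_le_ncard h2 (Finset.finite_toSet _)).trans ?_
    rw [Set.ncard_coe_finset]
    exact Finset.card_image_le
  rw [Finset.card_erase_of_mem h] at h3
  have : 0 < S.E.card := Finset.card_pos.2 ⟨_, h⟩
  omega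

open Classical in
theorem GSt.merge (S : GSt A) (u1 u2 : S.V) (c : A) :
    ∃ (S' : GSt A) (f : S.V → S'.V) (h : S.V → A), Function.Surjective f ∧ f u1 = f u2 ∧
      (h u1)⁻¹ * c * h u2 ∈ S'.stab (f u1) ∧
      (∀ u a, (u, a) ∈ S.K → (f u, (h u)⁻¹ * a * h u) ∈ S'.K) ∧
      S'.E = S.E.image (fun e => (f e.1, (h e.1)⁻¹ * e.2.1, e.2.2.1 * h e.2.2.2, f e.2.2.2)) ∧
      S'.K.card + Nat.card S.V ≤ S.K.card + Nat.card S'.V + 1 := by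
  have := S.fin
  by_cases e : u1 = u2
  · subst e
    refine ⟨⟨S.V, S.fin, insert (u1, c) S.K, S.E⟩, id, fun _ => 1, Function.surjective_id, rfl,
      ?_, ?_, ?_, ?_⟩
    · apply Subgroup.subset_closure; simp
    · intro u a h; simp [h]
    · simp
    · have := Finset.card_insert_le (u1, c) S.K
      simp only; omega
  · let f : S.V → {v // v ≠ u2} := fun v => if h : v = u2 then ⟨u1, e⟩ else ⟨v, h⟩
    let h : S.V → A := fun v => if v = u2 then c⁻¹ else 1
    refine ⟨⟨{v // v ≠ u2}, inferInstance, S.K.image (fun e => (f e.1, (h e.1)⁻¹ * e.2 * h e.1)),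
      S.E.image (fun e => (f e.1, (h e.1)⁻¹ * e.2.1, e.2.2.1 * h e.2.2.2, f e.2.2.2))⟩, f, h,
      ?_, ?_, ?_, ?_, ?_, ?_⟩
    · rintro ⟨v, hv⟩; exact ⟨v, by simp [f, hv]⟩
    · simp [f, e]
    · simp [h, e, one_mem]
    · intro u a hu
      exact Finset.mem_image.2 ⟨_, hu, rfl⟩
    · simp only
      congr!
    · have h1 := Finset.card_image_le (s := S.K) (f := fun e => (f e.1, (h e.1)⁻¹ * e.2 * h e.1))
      have h2 : Nat.card {v // v ≠ u2} + 1 = Nat.card S.V := by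
        have := Fintype.ofFinite S.V
        rw [Nat.card_eq_fintype_card, Nat.card_eq_fintype_card, Fintype.card_subtype_compl]
        have : 0 < Fintype.card S.V := Fintype.card_pos_iff.2 ⟨u2⟩
        simp; omega
      simp only; omega

theorem conn_of_map {S S' : GSt A} (f : S.V → S'.V) (hf : Function.Surjective f) (h : S.V → A)
    (hm : ∀ u g v, S.P u g v → S'.P (f u) ((Coprod.inl (h u))⁻¹ * g * Coprod.inl (h v)) (f v))
    (hc : S.Conn) : S'.Conn := by
  intro u v
  obtain ⟨u, rfl⟩ := hf u
  obtain ⟨v, rfl⟩ := hf v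
  obtain ⟨g, hg⟩ := hc u v
  exact ⟨_, hm _ _ _ hg⟩


open Classical in
theorem GSt.red (S S' : GSt A) (f : S.V → S'.V) (h : S.V → A) (hf : Function.Surjective f)
    (hK : ∀ u a, (u, a) ∈ S.K → (f u, (h u)⁻¹ * a * h u) ∈ S'.K)
    (hcard : S'.K.card + Nat.card S.V ≤ S.K.card + Nat.card S'.V + 1)
    (u1 u2 v1 v2 : S.V) (a1 a2 b1 b2 : A)
    (h1 : (u1, a1, b1, v1) ∈ S.E) (h2 : (u2, a2, b2, v2) ∈ S.E)
    (hne : (u1, a1, b1, v1) ≠ (u2, a2, b2, v2))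
    (hu : f u1 = f u2) (hv : f v1 = f v2)
    (hα : (h u1)⁻¹ * (a1 * a2⁻¹) * h u2 ∈ S'.stab (f u1))
    (hβ : (h v1)⁻¹ * (b1⁻¹ * b2) * h v2 ∈ S'.stab (f v1)) :
    ∃ (S' : GSt A) (f : S.V → S'.V) (h : S.V → A), Function.Surjective f ∧
      (∀ u g v, S.P u g v → S'.P (f u) ((Coprod.inl (h u))⁻¹ * g * Coprod.inl (h v)) (f v)) ∧
      S'.E.card < S.E.card ∧
      S'.K.card + S'.E.card + Nat.card S.V ≤ S.K.card + S.E.card + Nat.card S'.V := by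
  let m : S.V × A × A × S.V → S'.V × A × A × S'.V :=
    fun e => (f e.1, (h e.1)⁻¹ * e.2.1, e.2.2.1 * h e.2.2.2, f e.2.2.2)
  let T : GSt A := ⟨S'.V, S'.fin, S'.K, (S.E.erase (u1, a1, b1, v1)).image m⟩
  have hcE : T.E.card < S.E.card :=
    lt_of_le_of_lt Finset.card_image_le (Finset.card_erase_lt_of_mem h1)
  refine ⟨T, f, h, hf, ?_, hcE, ?_⟩
  · have hE : ∀ u a b v, (u, a, b, v) ∈ S.E → (u, a, b, v) ≠ (u1, a1, b1, v1) →
      T.P (f u) (Coprod.inl ((h u)⁻¹ * a) * tt * Coprod.inl (b * h v)) (f v) := by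
      intro u a b v he hn
      exact GSt.P.edge (S := T) _ _ _ _ (Finset.mem_image.2 ⟨_, Finset.mem_erase.2 ⟨hn, he⟩, rfl⟩)
    apply GSt.P_map (S' := T) f h
    · intro u a hk
      exact GSt.P.vtx (S := T) _ _ (hK u a hk)
    · intro u a b v he
      by_cases hn : (u, a, b, v) = (u1, a1, b1, v1)
      · cases hn
        have p1 : T.P (f u1) _ (f u1) := GSt.P_stab T _ _ hα
        have p2 := hE _ _ _ _ h2 hne.symm
        have p3 : T.P (f v1) _ (f v1) := (GSt.P_stab T _ _ hβ).inv
        rw [← hu, ← hv] at p2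
        have := (p1.mul _ _ _ _ _ p2).mul _ _ _ _ _ p3
        convert this using 1
        simp [mul_assoc]
      · exact hE _ _ _ _ he hn
  · change S'.K.card + T.E.card + _ ≤ _ + Nat.card S'.V
    omega

theorem GSt.fold (S : GSt A) (u1 u2 v1 v2 : S.V) (a1 a2 b1 b2 : A)
    (h1 : (u1, a1, b1, v1) ∈ S.E) (h2 : (u2, a2, b2, v2) ∈ S.E)
    (hne : (u1, a1, b1, v1) ≠ (u2, a2, b2, v2))
    (hh : (v1 = v2 ∧ b1⁻¹ * b2 ∈ S.stab v1) ∨ (u1 = u2 ∧ a1 * a2⁻¹ ∈ S.stab u1)) :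
    ∃ (S' : GSt A) (f : S.V → S'.V) (h : S.V → A), Function.Surjective f ∧
      (∀ u g v, S.P u g v → S'.P (f u) ((Coprod.inl (h u))⁻¹ * g * Coprod.inl (h v)) (f v)) ∧
      S'.E.card < S.E.card ∧
      S'.K.card + S'.E.card + Nat.card S.V ≤ S.K.card + S.E.card + Nat.card S'.V := by
  have stab_map : ∀ (S' : GSt A) (f : S.V → S'.V) (h : S.V → A)
      (_ : ∀ u a, (u, a) ∈ S.K → (f u, (h u)⁻¹ * a * h u) ∈ S'.K) (u : S.V) (a : A),
      a ∈ S.stab u → (h u)⁻¹ * a * h u ∈ S'.stab (f u) := by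
    intro S' f h hK u a ha
    induction ha using Subgroup.closure_induction with
    | mem x hx => exact Subgroup.subset_closure (hK _ _ hx)
    | one => simp [one_mem]
    | mul x y _ _ h1 h2 => simpa [mul_assoc] using mul_mem h1 h2
    | inv x _ h1 => simpa [mul_assoc] using inv_mem h1
  obtain ⟨rfl, hb⟩ | ⟨rfl, ha⟩ := hh
  · obtain ⟨S', f, h, hf, hu, hα, hK, -, hcard⟩ := S.merge u1 u2 (a1 * a2⁻¹)
    exact S.red S' f h hf hK hcard u1 u2 v1 v1 a1 a2 b1 b2 h1 h2 hne hu rfl hα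
      (stab_map S' f h hK _ _ hb)
  · obtain ⟨S', f, h, hf, hu, hα, hK, -, hcard⟩ := S.merge v1 v2 (b1⁻¹ * b2)
    exact S.red S' f h hf hK hcard u1 u1 v1 v2 a1 a2 b1 b2 h1 h2 hne rfl hu
      (stab_map S' f h hK _ _ ha) hα

/-- `S` carries the set `C` with budget `k`. -/
def GSt.Good (S : GSt A) (C : Set (Coprod A (Multiplicative ℤ))) (k : ℕ) : Prop :=
  S.Conn ∧ S.K.card + S.E.card + 1 ≤ k + Nat.card S.V ∧
    ∃ u x, ∀ g ∈ C, S.P u ((Coprod.inl x)⁻¹ * g * Coprod.inl x) u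

theorem GSt.Good.final (C : Set (Coprod A (Multiplicative ℤ))) (k : ℕ) (ht : tt ∈ C) (n : ℕ) :
    ∀ S : GSt A, S.E.card = n → S.Good C k →
    ∃ D : Finset A, D.card + 1 ≤ k ∧ ∀ a, Coprod.inl a ∈ C → a ∈ Subgroup.closure (D : Set A) := by
  classical
  induction n using Nat.strong_induction_on with | _ n ih =>
  rintro S hn ⟨hc, hk, u, x, hC⟩
  by_cases hfold : ∃ (u1 u2 v1 v2 : S.V) (a1 a2 b1 b2 : A),
    (u1, a1, b1, v1) ∈ S.E ∧ (u2, a2, b2, v2) ∈ S.E ∧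
    (u1, a1, b1, v1) ≠ (u2, a2, b2, v2) ∧
    ((v1 = v2 ∧ b1⁻¹ * b2 ∈ S.stab v1) ∨ (u1 = u2 ∧ a1 * a2⁻¹ ∈ S.stab u1))
  · obtain ⟨u1, u2, v1, v2, a1, a2, b1, b2, h1, h2, hne, hh⟩ := hfold
    obtain ⟨S', f, h, hf, hP, hlt, hcard⟩ := S.fold _ _ _ _ _ _ _ _ h1 h2 hne hh
    refine ih _ (hn ▸ hlt) S' rfl ⟨conn_of_map f hf h hP hc, by omega, f u, x * h u, ?_⟩
    intro g hg
    simpa [mul_assoc] using hP _ _ _ (hC g hg)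
  · have key : ∀ (u1 u2 v1 v2 : S.V) (a1 a2 b1 b2 : A),
      (u1, a1, b1, v1) ∈ S.E → (u2, a2, b2, v2) ∈ S.E →
      ((v1 = v2 ∧ b1⁻¹ * b2 ∈ S.stab v1) ∨ (u1 = u2 ∧ a1 * a2⁻¹ ∈ S.stab u1)) →
      (u1, a1, b1, v1) = (u2, a2, b2, v2) := by
      intro u1 u2 v1 v2 a1 a2 b1 b2 h1 h2 h3
      by_contra h4
      exact hfold ⟨u1, u2, v1, v2, a1, a2, b1, b2, h1, h2, h4, h3⟩
    obtain ⟨f1, f2⟩ := S.folded (by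
      rintro _ _ _ ⟨u1, a1, b1, v1, h1, rfl, rfl⟩ ⟨u2, a2, b2, v2, h2, e, rfl⟩
      obtain ⟨rfl, e⟩ := Sigma.mk.inj e
      have := key _ _ _ _ _ _ _ _ h1 h2 (Or.inl ⟨rfl, QuotientGroup.eq.1 (eq_of_heq e)⟩)
      cases this; rfl) (by
      rintro _ _ _ ⟨u1, a1, b1, v1, h1, rfl, rfl⟩ ⟨u2, a2, b2, v2, h2, rfl, e⟩
      obtain ⟨rfl, e⟩ := Sigma.mk.inj e
      have := key _ _ _ _ _ _ _ _ h1 h2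
        (Or.inr ⟨rfl, by simpa using QuotientGroup.eq.1 (eq_of_heq e)⟩)
      cases this; rfl)
    obtain ⟨a, b, hE⟩ := f2 u x (hC _ ht)
    have hV := S.card_le hc _ _ _ hE
    refine ⟨S.K.image (fun p => x * p.2 * x⁻¹), ?_, ?_⟩
    · have := Finset.card_image_le (s := S.K) (f := fun p => x * p.2 * x⁻¹)
      omega
    · intro a ha
      have h1 : x⁻¹ * a * x ∈ S.stab u := f1 u _ (by simpa using hC _ ha)
      have h2 : S.stab u ≤ (Subgroup.closure
          ((S.K.image (fun p => x * p.2 * x⁻¹) : Finset A) : Set A)).comap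
          (MulAut.conj x).toMonoidHom := by
        rw [GSt.stab, Subgroup.closure_le]
        intro b hb
        apply Subgroup.subset_closure
        simp only [Finset.coe_image, Set.mem_image]
        exact ⟨_, hb, rfl⟩
      simpa [mul_assoc] using h2 h1

/-- One can add an arc labelled `g`. -/
def AddArc (g : Coprod A (Multiplicative ℤ)) : Prop :=
  ∀ (S : GSt A) (u v : S.V) (a : A), S.Conn →
    ∃ (S' : GSt A) (f : S.V → S'.V) (h : S.V → A), S'.Conn ∧
      (∀ u g v, S.P u g v → S'.P (f u) ((Coprod.inl (h u))⁻¹ * g * Coprod.inl (h v)) (f v)) ∧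
      S'.P (f u) ((Coprod.inl (h u))⁻¹ * (Coprod.inl a * g) * Coprod.inl (h v)) (f v) ∧
      S'.K.card + S'.E.card + Nat.card S.V ≤ S.K.card + S.E.card + Nat.card S'.V + 1

theorem addArc_one : AddArc (1 : Coprod A (Multiplicative ℤ)) := by
  classical
  intro S u v a hc
  obtain ⟨S', f, h, hf, hu, hα, hK, hE, hcard⟩ := S.merge u v a
  have hP : ∀ u g v, S.P u g v →
      S'.P (f u) ((Coprod.inl (h u))⁻¹ * g * Coprod.inl (h v)) (f v) := by
    apply GSt.P_map f h
    · intro u a hk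
      exact GSt.P.vtx (S := S') _ _ (hK u a hk)
    · intro u a b v he
      apply GSt.P.edge (S := S')
      rw [hE]
      exact Finset.mem_image.2 ⟨_, he, rfl⟩
  refine ⟨S', f, h, conn_of_map f hf h hP hc, hP, ?_, ?_⟩
  · have := S'.P_stab _ _ hα
    rw [← hu]
    simpa using this
  · have : S'.E.card ≤ S.E.card := by rw [hE]; exact Finset.card_image_le
    omega

open Classical in
theorem GSt.addPendant (S : GSt A) (e : Option S.V × A × A × Option S.V) (hc : S.Conn)
    (he : (∃ u, e.1 = some u ∧ e.2.2.2 = none) ∨ (∃ u, e.1 = none ∧ e.2.2.2 = some u)) :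
    let S' : GSt A := ⟨Option S.V, (have := S.fin; inferInstance),
      S.K.image (fun p => (some p.1, p.2)),
      insert e (S.E.image (fun p => (some p.1, p.2.1, p.2.2.1, some p.2.2.2)))⟩
    S'.Conn ∧ (∀ u g v, S.P u g v → S'.P (some u) g (some v)) ∧
      S'.K.card + S'.E.card + Nat.card S.V ≤ S.K.card + S.E.card + Nat.card S'.V := by
  intro S'
  have := S.fin
  have hP : ∀ u g v, S.P u g v → S'.P (some u) g (some v) := by
    intro u g v hp
    have := GSt.P_map (S := S) (S' := S') some (fun _ => 1) (by
      intro u a h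
      apply GSt.P.vtx (S := S')
      exact Finset.mem_image.2 ⟨_, h, by simp⟩) (by
      intro u a b v h
      apply GSt.P.edge (S := S')
      exact Finset.mem_insert_of_mem (Finset.mem_image.2 ⟨_, h, by simp⟩)) u g v hp
    simpa using this
  refine ⟨?_, hP, ?_⟩
  · have hn : ∃ (u : S.V) (g : _), S'.P (some u) g none := by
      have hE : S'.P e.1 _ e.2.2.2 := GSt.P.edge (S := S') e.1 e.2.1 e.2.2.1 e.2.2.2
        (Finset.mem_insert_self _ _)
      obtain ⟨u, h1, h2⟩ | ⟨u, h1, h2⟩ := he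
      · rw [h1, h2] at hE; exact ⟨u, _, hE⟩
      · rw [h1, h2] at hE; exact ⟨u, _, hE.inv⟩
    obtain ⟨u0, g0, h0⟩ := hn
    have h1 : ∀ w : S'.V, ∃ g, S'.P (some u0) g w := by
      rintro (_ | w)
      · exact ⟨_, h0⟩
      · obtain ⟨g, hg⟩ := hc u0 w
        exact ⟨_, hP _ _ _ hg⟩
    intro u v
    obtain ⟨g, hg⟩ := h1 u
    obtain ⟨k, hk⟩ := h1 v
    exact ⟨_, hg.inv.mul _ _ _ _ _ hk⟩
  · have h1 : S'.K.card ≤ S.K.card := Finset.card_image_le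
    have h2 : S'.E.card ≤ S.E.card + 1 :=
      (Finset.card_insert_le _ _).trans (Nat.succ_le_succ Finset.card_image_le)
    have h3 : Nat.card S'.V = Nat.card S.V + 1 := Finite.card_option
    omega

theorem addArc_step (S : GSt A) (g y : Coprod A (Multiplicative ℤ)) (u v : S.V)
    (a : A) (hg : AddArc g) (e : Option S.V × A × A × Option S.V) (hc : S.Conn)
    (he : (e.1 = some u ∧ e.2.2.2 = none ∧ Coprod.inl e.2.1 * tt * Coprod.inl e.2.2.1 =
        Coprod.inl a * y) ∨
      (e.1 = none ∧ e.2.2.2 = some u ∧ (Coprod.inl e.2.1 * tt * Coprod.inl e.2.2.1)⁻¹ =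
        Coprod.inl a * y)) :
    ∃ (S' : GSt A) (f : S.V → S'.V) (h : S.V → A), S'.Conn ∧
      (∀ u g v, S.P u g v → S'.P (f u) ((Coprod.inl (h u))⁻¹ * g * Coprod.inl (h v)) (f v)) ∧
      S'.P (f u) ((Coprod.inl (h u))⁻¹ * (Coprod.inl a * (y * g)) * Coprod.inl (h v)) (f v) ∧
      S'.K.card + S'.E.card + Nat.card S.V ≤ S.K.card + S.E.card + Nat.card S'.V + 1 := by
  classical
  have hpd := S.addPendant e hc (by
    obtain ⟨h1, h2, _⟩ | ⟨h1, h2, _⟩ := he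
    · exact Or.inl ⟨_, h1, h2⟩
    · exact Or.inr ⟨_, h1, h2⟩)
  set S1 : GSt A := ⟨Option S.V, (have := S.fin; inferInstance),
      S.K.image (fun p => (some p.1, p.2)),
      insert e (S.E.image (fun p => (some p.1, p.2.1, p.2.2.1, some p.2.2.2)))⟩ with hS1
  obtain ⟨hc1, hP1, hcard1⟩ := hpd
  have hcard1 : S1.K.card + S1.E.card + Nat.card S.V ≤ S.K.card + S.E.card + Nat.card S1.V :=
    hcard1
  have hE : S1.P e.1 (Coprod.inl e.2.1 * tt * Coprod.inl e.2.2.1) e.2.2.2 :=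
    GSt.P.edge (S := S1) e.1 e.2.1 e.2.2.1 e.2.2.2 (Finset.mem_insert_self _ _)
  have hw : S1.P (some u) (Coprod.inl a * y) none := by
    obtain ⟨h1, h2, h3⟩ | ⟨h1, h2, h3⟩ := he
    · rw [← h3, ← h1, ← h2]; exact hE
    · rw [← h3, ← h1, ← h2]; exact hE.inv
  obtain ⟨S2, f, h, hc2, hP2, hq, hcard2⟩ := hg S1 none (some v) 1 hc1
  refine ⟨S2, fun z => f (some z), fun z => h (some z), hc2, ?_, ?_, by omega⟩
  · intro u g v hp
    exact hP2 _ _ _ (hP1 _ _ _ hp)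
  · have := (hP2 _ _ _ hw).mul _ _ _ _ _ hq
    convert this using 1
    simp [mul_assoc]

theorem addArc (g : Coprod A (Multiplicative ℤ)) : AddArc g := by
  have M : ∀ y g : Coprod A (Multiplicative ℤ), AddArc g → AddArc (y * g) := by
    intro y
    induction y using Coprod.induction_on with
    | inl b =>
      intro g hg S u v a hc
      have := hg S u v (a * b) hc
      simpa [mul_assoc] using this
    | inr n =>
      have ht1 : ∀ g : Coprod A (Multiplicative ℤ), AddArc g → AddArc (tt * g) := by
        intro g hg S u v a hc
        exact addArc_step S g tt u v a hg (some u, a, 1, none) hc (Or.inl ⟨rfl, rfl, by simp⟩)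
      have ht2 : ∀ g : Coprod A (Multiplicative ℤ), AddArc g → AddArc (tt⁻¹ * g) := by
        intro g hg S u v a hc
        exact addArc_step S g tt⁻¹ u v a hg (none, 1, a⁻¹, some u) hc
          (Or.inr ⟨rfl, rfl, by simp⟩)
      have hz : ∀ n : ℤ, ∀ g : Coprod A (Multiplicative ℤ), AddArc g → AddArc (tt ^ n * g) := by
        intro n
        induction n using Int.induction_on with
        | zero => intro g hg; simpa using hg
        | succ i ih =>
          intro g hg
          rw [zpow_add_one, mul_assoc]
          exact ih _ (ht1 _ hg)
        | pred i ih =>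
          intro g hg
          rw [zpow_sub_one, mul_assoc]
          exact ih _ (ht2 _ hg)
      have : (Coprod.inr n : Coprod A (Multiplicative ℤ)) = tt ^ (Multiplicative.toAdd n) := by
        rw [tt, ← map_zpow, ← ofAdd_zsmul]; simp
      rw [this]
      exact hz _
    | mul x y hx hy =>
      intro g hg
      rw [mul_assoc]
      exact hx _ (hy _ hg)
  simpa using M g 1 addArc_one

theorem exists_good (D : Finset (Coprod A (Multiplicative ℤ))) :
    ∃ S : GSt A, S.Good (D : Set (Coprod A (Multiplicative ℤ))) D.card := by
  classical
  induction D using Finset.induction_on with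
  | empty =>
    refine ⟨⟨Unit, inferInstance, ∅, ∅⟩, ?_, ?_, (), 1, ?_⟩
    · intro u v; exact ⟨1, .one _⟩
    · simp
    · simp
  | insert g D hg ih =>
    obtain ⟨S, hc, hcard, u, x, hP⟩ := ih
    obtain ⟨S', f, h, hc', hP', hq, hcard'⟩ :=
      addArc (g * Coprod.inl x) S u u x⁻¹ hc
    refine ⟨S', hc', ?_, f u, x * h u, ?_⟩
    · rw [Finset.card_insert_of_notMem hg]; omega
    · intro k hk
      rw [Finset.coe_insert, Set.mem_insert_iff] at hk
      obtain rfl | hk := hk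
      · simpa [mul_assoc] using hq
      · simpa [mul_assoc] using hP' _ _ _ (hP _ hk)

theorem GSt.Good.closure {S : GSt A} {C : Set (Coprod A (Multiplicative ℤ))} {k : ℕ}
    (h : S.Good C k) : S.Good (Subgroup.closure C : Set (Coprod A (Multiplicative ℤ))) k := by
  obtain ⟨hc, hcard, u, x, hP⟩ := h
  refine ⟨hc, hcard, u, x, ?_⟩
  intro g hg
  induction hg using Subgroup.closure_induction with
  | mem y hy => exact hP y hy
  | one => simpa using GSt.P.one u
  | mul y z _ _ h1 h2 => simpa [mul_assoc] using h1.mul _ _ _ _ _ h2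
  | inv y _ h1 => simpa [mul_assoc] using h1.inv

theorem subgroupRank_le_iff {G : Type*} [Group G] (H : Subgroup G) (r : ℕ) :
    subgroupRank H ≤ r ↔ ∃ S : Finset G, Subgroup.closure (S : Set G) = H ∧ S.card ≤ r := by
  constructor
  · intro h
    by_contra! hn
    have : ((r + 1 : ℕ) : ℕ∞) ≤ subgroupRank H := by
      refine le_iInf fun S => le_iInf fun hS => ?_
      exact_mod_cast hn S hS
    have := this.trans h
    norm_cast at this
    omega
  · rintro ⟨S, hS, hr⟩
    exact (iInf₂_le S hS).trans (by exact_mod_cast hr)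

theorem localRank_eq_iff {G : Type*} [Group G] (H : Subgroup G) (r : ℕ) :
    localRank H = r ↔ LocalRankLE H r ∧ ∀ k, LocalRankLE H k → r ≤ k := by
  constructor
  · intro h
    have h2 : ∀ k, LocalRankLE H k → r ≤ k := by
      intro k hk
      have : localRank H ≤ k := iInf₂_le k hk
      rw [h] at this
      exact_mod_cast this
    refine ⟨?_, h2⟩
    by_contra hn
    have : ((r + 1 : ℕ) : ℕ∞) ≤ localRank H := by
      refine le_iInf fun k => le_iInf fun hk => ?_
      have := h2 k hk
      have : k ≠ r := by rintro rfl; exact hn hk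
      have : r + 1 ≤ k := by omega
      exact_mod_cast this
    rw [h] at this
    norm_cast at this
    omega
  · rintro ⟨h1, h2⟩
    apply le_antisymm
    · exact iInf₂_le r h1
    · refine le_iInf fun k => le_iInf fun hk => ?_
      exact_mod_cast h2 k hk

theorem lower {k : ℕ} (h : LocalRankLE (⊤ : Subgroup (Coprod A (Multiplicative ℤ))) k)
    (B : Subgroup A) (hB : B.FG) :
    ∃ D : Finset A, D.card + 1 ≤ k ∧ B ≤ Subgroup.closure (D : Set A) := by
  classical
  have hBm : (B.map (Coprod.inl : A →* Coprod A (Multiplicative ℤ))).FG := by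
    obtain ⟨D, rfl⟩ := hB
    exact ⟨D.image Coprod.inl, by rw [MonoidHom.map_closure, Finset.coe_image]⟩
  obtain ⟨C, -, hC, hr⟩ := h (B.map Coprod.inl ⊔ Subgroup.zpowers tt) le_top
    (hBm.sup ⟨{tt}, by simp [Subgroup.zpowers_eq_closure]⟩)
  obtain ⟨D, rfl, hD⟩ := (subgroupRank_le_iff _ _).1 hr
  obtain ⟨S, hS⟩ := exists_good D
  obtain ⟨D', h1, h2⟩ := GSt.Good.final _ _
    (hC (Subgroup.mem_sup_right (Subgroup.mem_zpowers _))) _ S rfl hS.closure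
  exact ⟨D', h1.trans hD, fun b hb => h2 _ (hC (Subgroup.mem_sup_left ⟨b, hb, rfl⟩))⟩

theorem exists_fg (g : Coprod A (Multiplicative ℤ)) :
    ∃ B : Subgroup A, B.FG ∧ g ∈ B.map Coprod.inl ⊔ Subgroup.zpowers tt := by
  induction g using Coprod.induction_on with
  | inl a => exact ⟨Subgroup.closure {a}, ⟨{a}, by simp⟩, Subgroup.mem_sup_left
      ⟨a, Subgroup.subset_closure rfl, rfl⟩⟩
  | inr n =>
    refine ⟨⊥, ⟨∅, by simp⟩, Subgroup.mem_sup_right ⟨Multiplicative.toAdd n, ?_⟩⟩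
    change tt ^ _ = _
    rw [tt, ← map_zpow, ← ofAdd_zsmul]; simp
  | mul x y hx hy =>
    obtain ⟨B1, h1, hx⟩ := hx
    obtain ⟨B2, h2, hy⟩ := hy
    refine ⟨B1 ⊔ B2, h1.sup h2, mul_mem ?_ ?_⟩
    · exact sup_le_sup_right (Subgroup.map_mono le_sup_left) _ hx
    · exact sup_le_sup_right (Subgroup.map_mono le_sup_right) _ hy

theorem upper {r : ℕ} (h : LocalRankLE (⊤ : Subgroup A) r) :
    LocalRankLE (⊤ : Subgroup (Coprod A (Multiplicative ℤ))) (r + 1) := by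
  classical
  rintro _ - ⟨D, rfl⟩
  have : ∃ B : Subgroup A, B.FG ∧
      (D : Set (Coprod A (Multiplicative ℤ))) ⊆ (B.map Coprod.inl ⊔ Subgroup.zpowers tt :
        Subgroup (Coprod A (Multiplicative ℤ))) := by
    induction D using Finset.induction_on with
    | empty => exact ⟨⊥, ⟨∅, by simp⟩, by simp⟩
    | insert g D hg ih =>
      obtain ⟨B1, h1, hx⟩ := ih
      obtain ⟨B2, h2, hy⟩ := exists_fg g
      refine ⟨B1 ⊔ B2, h1.sup h2, ?_⟩
      rw [Finset.coe_insert, Set.insert_subset_iff]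
      constructor
      · exact sup_le_sup_right (Subgroup.map_mono le_sup_right) _ hy
      · exact fun z hz => sup_le_sup_right (Subgroup.map_mono le_sup_left) _ (hx hz)
  obtain ⟨B, hB, hD⟩ := this
  obtain ⟨C, -, hBC, hC⟩ := h B le_top hB
  obtain ⟨E, rfl, hE⟩ := (subgroupRank_le_iff _ _).1 hC
  refine ⟨(Subgroup.closure (E : Set A)).map Coprod.inl ⊔ Subgroup.zpowers tt, le_top, ?_, ?_⟩
  · rw [Subgroup.closure_le]
    exact fun z hz => sup_le_sup_right (Subgroup.map_mono hBC) _ (hD hz)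
  · rw [subgroupRank_le_iff]
    refine ⟨insert tt (E.image Coprod.inl), ?_, ?_⟩
    · rw [MonoidHom.map_closure, Subgroup.zpowers_eq_closure, ← Subgroup.closure_union]
      congr 1
      rw [Finset.coe_insert, Finset.coe_image, Set.union_comm]
      rfl
    · exact (Finset.card_insert_le _ _).trans
        (Nat.succ_le_succ (Finset.card_image_le.trans hE))

end




/-- Let `A` be a group whose local rank equals a finite nonnegative integer `r`, and let
`⟨t⟩` be an infinite cyclic group. Then the free product `A ∗ ⟨t⟩` has local rank exactly
`r + 1`. -/
theorem free_prod_localRank {A : Type*} [Group A] (r : ℕ)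
    (h : localRank (⊤ : Subgroup A) = (r : ℕ∞)) :
    localRank (⊤ : Subgroup (Monoid.Coprod A (Multiplicative ℤ))) = ((r + 1 : ℕ) : ℕ∞) := by
  rw [localRank_eq_iff] at h ⊢
  refine ⟨upper h.1, fun k hk => ?_⟩
  obtain ⟨D, hD, -⟩ := lower hk ⊥ ⟨∅, by simp⟩
  obtain ⟨k, rfl⟩ : ∃ j, k = j + 1 := ⟨k - 1, by omega⟩
  refine Nat.succ_le_succ (h.2 k ?_)
  intro B _ hB
  obtain ⟨D, hD, hBD⟩ := lower hk B hB
  exact ⟨_, le_top, hBD, (subgroupRank_le_iff _ _).2 ⟨D, rfl, by omega⟩⟩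
end

section
/- Let k be a strictly positive integer, let Γ be a k-free group, let S be a finite subset of Γ such that the subgroup ⟨S⟩ generated by S has rank at least k, and let x₀ be a non-trivial element of S. Then there are elements x₁, …, x_{k−1} of S such that x₀, x₁, …, x_{k−1} are independent. -/
universe u

theorem aux_resfin {α : Type u} (w : FreeGroup α) (hw : w ≠ 1) :
    ∃ (V : Type u) (_ : Finite V) (f : FreeGroup α →* Equiv.Perm V), f w ≠ 1 := by
  classical
  let V : Set (FreeGroup α) := {v | ∃ L, L <:+ w.toWord ∧ v = FreeGroup.mk L}
  have hV : V.Finite := by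
    have : V = FreeGroup.mk '' {L | L ∈ w.toWord.tails} := by
      ext v
      simp only [V, Set.mem_ofPred_eq, List.mem_tails, Set.mem_image]
      constructor
      · rintro ⟨L, h, rfl⟩; exact ⟨L, h, rfl⟩
      · rintro ⟨L, h, rfl⟩; exact ⟨L, h, rfl⟩
    rw [this]
    exact (List.finite_toSet _).image _
  have : Finite V := hV
  have : Fintype V := Fintype.ofFinite _
  have hext : ∀ a : α, ∃ e : Equiv.Perm V, ∀ v v' : V,
      (v' : FreeGroup α) = FreeGroup.of a * v → e v = v' := by
    intro a
    let p : V → Prop := fun v => FreeGroup.of a * (v : FreeGroup α) ∈ V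
    let q : V → Prop := fun v => (FreeGroup.of a)⁻¹ * (v : FreeGroup α) ∈ V
    let e : {v : V // p v} ≃ {v : V // q v} :=
      { toFun := fun v => ⟨⟨FreeGroup.of a * v.1.1, v.2⟩, by
          simp only [q, inv_mul_cancel_left]; exact v.1.2⟩
        invFun := fun v => ⟨⟨(FreeGroup.of a)⁻¹ * v.1.1, v.2⟩, by
          simp only [p, mul_inv_cancel_left]; exact v.1.2⟩
        left_inv := fun v => by ext; simp
        right_inv := fun v => by ext; simp }
    refine ⟨e.extendSubtype, fun v v' h => ?_⟩
    have hp : p v := by simp only [p]; rw [← h]; exact v'.2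
    rw [Equiv.extendSubtype_apply_of_mem e v hp]
    ext
    exact h.symm
  choose e he using hext
  refine ⟨↥V, inferInstance, FreeGroup.lift e, fun h => hw ?_⟩
  have h1 : (1 : FreeGroup α) ∈ V := ⟨[], List.nil_suffix, rfl⟩
  have key : ∀ L : List (α × Bool), ∀ hL : L <:+ w.toWord,
      FreeGroup.lift e (FreeGroup.mk L) ⟨1, h1⟩ = ⟨FreeGroup.mk L, L, hL, rfl⟩ := by
    intro L
    induction L with
    | nil => intro hL; exact congrFun (congrArg _ (map_one (FreeGroup.lift e))) _
    | cons c L ih =>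
      intro hL
      have hL' : L <:+ w.toWord := (List.suffix_cons c L).trans hL
      have hmul : FreeGroup.mk (c :: L) = FreeGroup.mk [c] * FreeGroup.mk L := by
        rw [FreeGroup.mul_mk]; rfl
      obtain ⟨a, b⟩ := c
      have : FreeGroup.lift e (FreeGroup.mk ((a, b) :: L)) ⟨1, h1⟩
        = FreeGroup.lift e (FreeGroup.mk [(a, b)]) ⟨FreeGroup.mk L, L, hL', rfl⟩ := by
        rw [hmul, map_mul, Equiv.Perm.mul_apply, ih hL']
      rw [this]
      cases b
      · have h2 : FreeGroup.mk [(a, false)] = (FreeGroup.of a)⁻¹ := by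
          simp [FreeGroup.of, FreeGroup.inv_mk, FreeGroup.invRev]
        rw [h2, map_inv, FreeGroup.lift_apply_of, Equiv.Perm.inv_eq_iff_eq]
        symm
        apply he
        simp only
        rw [hmul, h2, mul_inv_cancel_left]
      · have h2 : FreeGroup.mk [(a, true)] = FreeGroup.of a := rfl
        rw [h2, FreeGroup.lift_apply_of]
        apply he
        simp only
        rw [hmul, h2]
  have := key w.toWord List.suffix_rfl
  have := congrArg Subtype.val this
  simp only [FreeGroup.mk_toWord, h] at this
  exact this.symm

theorem aux_hopf {α : Type*} [Finite α] (f : FreeGroup α →* FreeGroup α)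
    (hf : Function.Surjective f) : Function.Injective f := by
  rw [injective_iff_map_eq_one]
  intro w hw
  by_contra hne
  obtain ⟨V, _, q, hq⟩ := aux_resfin w hne
  have : Finite (FreeGroup α →* Equiv.Perm V) := Finite.of_equiv _ FreeGroup.lift
  have hinj : Function.Injective
      (fun φ : FreeGroup α →* Equiv.Perm V => φ.comp f) := by
    intro φ ψ h
    exact (MonoidHom.cancel_right hf).1 h
  obtain ⟨φ, hφ⟩ := (Finite.injective_iff_surjective.1 hinj) q
  apply hq
  rw [← hφ]
  simp [hw]

theorem aux_rank {X : Type*} {n : ℕ} (f : FreeGroup (Fin n) →* FreeGroup X)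
    (hf : Function.Surjective f) : Finite X ∧ Nat.card X ≤ n := by
  classical
  let C := Multiplicative (ZMod 2)
  have hC : Nat.card C = 2 := by
    exact Nat.card_zmod 2
  let F : (X → C) → (Fin n → C) := fun g =>
    FreeGroup.lift.symm ((FreeGroup.lift g).comp f)
  have hF : Function.Injective F := by
    intro g h hgh
    exact FreeGroup.lift.injective ((MonoidHom.cancel_right hf).1 (FreeGroup.lift.symm.injective hgh))
  have : Finite C := Nat.finite_of_card_ne_zero (by rw [hC]; norm_num)
  have : Finite (X → C) := Finite.of_injective F hF
  have : Nontrivial C := inferInstanceAs (Nontrivial (Multiplicative (ZMod 2)))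
  have hX : Finite X := by
    obtain ⟨a, b, hab⟩ := exists_pair_ne C
    refine Finite.of_injective (fun x : X => (fun y => if y = x then a else b : X → C)) ?_
    intro x y h
    have := congrFun h x
    by_contra hne
    simp [hne, hab] at this
  refine ⟨hX, ?_⟩
  have := Nat.card_le_card_of_injective F hF
  rw [Nat.card_fun, Nat.card_fun, hC, Nat.card_fin] at this
  exact (Nat.pow_le_pow_iff_right (by norm_num)).1 this

theorem aux_rank_le {Γ : Type*} [Group Γ] {n : ℕ} (y : Fin n → Γ) :
    subgroupRank (Subgroup.closure (Set.range y)) ≤ (n : ℕ∞) := by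
  classical
  refine (iInf₂_le (Finset.univ.image y) (by simp)).trans ?_
  exact_mod_cast Finset.card_image_le.trans (by simp)

theorem aux_key {Γ : Type*} [Group Γ] {k : ℕ} (hfree : KFree Γ k) {n : ℕ} (hn : n ≤ k)
    (y : Fin n → Γ) : Function.Injective (FreeGroup.lift y) ∨
      ∃ m < n, ∃ z : Fin m → Γ,
        Subgroup.closure (Set.range z) = Subgroup.closure (Set.range y) := by
  set H := Subgroup.closure (Set.range y) with hH
  have : IsFreeGroup H := hfree H ((aux_rank_le y).trans (by exact_mod_cast hn))
  let φ : FreeGroup (IsFreeGroup.Generators H) ≃* H := IsFreeGroup.mulEquiv H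
  have hr : (FreeGroup.lift y).range = H := by rw [FreeGroup.range_lift_eq_closure]
  let ψ : FreeGroup (Fin n) →* H := (FreeGroup.lift y).codRestrict H
    (fun w => by rw [← hr]; exact ⟨w, rfl⟩)
  have hψ : Function.Surjective ψ := by
    rintro ⟨h, hh⟩
    rw [← hr] at hh
    obtain ⟨w, hw⟩ := hh
    exact ⟨w, Subtype.ext hw⟩
  have hs : Function.Surjective (φ.symm.toMonoidHom.comp ψ) :=
    φ.symm.surjective.comp hψ
  obtain ⟨hX, hcard⟩ := aux_rank _ hs
  let e := Finite.equivFin (IsFreeGroup.Generators H)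
  rcases hcard.lt_or_eq with hlt | heq
  · right
    refine ⟨_, hlt, fun i => ((φ (FreeGroup.of (e.symm i)) : H) : Γ), ?_⟩
    have h1 : FreeGroup.lift (fun i => ((φ (FreeGroup.of (e.symm i)) : H) : Γ))
        = (H.subtype.comp φ.toMonoidHom).comp (FreeGroup.freeGroupCongr e.symm).toMonoidHom := by
      ext i; simp
    rw [← FreeGroup.range_lift_eq_closure, h1, MonoidHom.range_comp,
      MonoidHom.range_eq_top (f := (FreeGroup.freeGroupCongr e.symm).toMonoidHom).2 (FreeGroup.freeGroupCongr e.symm).surjective,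
      ← MonoidHom.range_eq_map, MonoidHom.range_comp,
      MonoidHom.range_eq_top (f := φ.toMonoidHom).2 φ.surjective, ← MonoidHom.range_eq_map, Subgroup.range_subtype]
  · left
    let e' : IsFreeGroup.Generators H ≃ Fin n := e.trans (finCongr heq)
    have := aux_hopf ((FreeGroup.freeGroupCongr e').toMonoidHom.comp
      (φ.symm.toMonoidHom.comp ψ)) ((FreeGroup.freeGroupCongr e').surjective.comp hs)
    intro a b hab
    apply this
    have : ψ a = ψ b := Subtype.ext hab
    simp [this]

theorem aux_ext {m n : ℕ} (u : Fin m → FreeGroup (Fin n))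
    (hu : Function.Injective (FreeGroup.lift u)) :
    Function.Injective (FreeGroup.lift
      (Fin.snoc (fun i => FreeGroup.map Fin.castSucc (u i)) (FreeGroup.of (Fin.last n)) :
        Fin (m+1) → FreeGroup (Fin (n+1)))) := by
  classical
  let G := FreeGroup (Fin (m+1))
  let B := FreeGroup (Fin n)
  let ρ : G →* FreeGroup (Fin m) :=
    FreeGroup.lift (Fin.snoc (fun i => FreeGroup.of i) 1 : Fin (m+1) → FreeGroup (Fin m))
  let ι : FreeGroup (Fin m) →* G := FreeGroup.map Fin.castSucc
  have hρι : ∀ i, ρ (FreeGroup.of (Fin.castSucc i)) = FreeGroup.of i := by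
    intro i; exact (FreeGroup.lift_apply_of).trans (Fin.snoc_castSucc ..)
  let j : G → B × G := fun g => (FreeGroup.lift u (ρ g), (ι (ρ g))⁻¹ * g)
  have hj : Function.Injective j := by
    intro g h hgh
    have h1 : ρ g = ρ h := hu (congrArg Prod.fst hgh)
    have h2 : (ι (ρ g))⁻¹ * g = (ι (ρ h))⁻¹ * h := congrArg Prod.snd hgh
    rw [h1] at h2
    exact mul_left_cancel h2
  let T : Equiv.Perm (B × G) :=
    (Equiv.mulLeft (FreeGroup.of (Fin.last m) : G)).extendDomain (Equiv.ofInjective j hj)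
  have hT : ∀ g : G, T (j g) = j (FreeGroup.of (Fin.last m) * g) := by
    intro g
    have := Equiv.Perm.extendDomain_apply_image
      (Equiv.mulLeft (FreeGroup.of (Fin.last m) : G)) (Equiv.ofInjective j hj) g
    simpa using this
  let L : B →* Equiv.Perm (B × G) :=
    { toFun := fun b => (Equiv.mulLeft b).prodCongr (Equiv.refl G)
      map_one' := by ext x <;> simp
      map_mul' := fun a b => by ext x <;> simp [mul_assoc] }
  let Φ : FreeGroup (Fin (n+1)) →* Equiv.Perm (B × G) :=
    FreeGroup.lift (Fin.snoc (fun i => L (FreeGroup.of i)) T : Fin (n+1) → Equiv.Perm (B × G))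
  have hΦ1 : Φ.comp (FreeGroup.map Fin.castSucc) = L := by
    ext1 i; simp [Φ]
  have hΦ2 : Φ (FreeGroup.of (Fin.last n)) = T := by simp [Φ]
  set θ := FreeGroup.lift
      (Fin.snoc (fun i => FreeGroup.map Fin.castSucc (u i)) (FreeGroup.of (Fin.last n)) :
        Fin (m+1) → FreeGroup (Fin (n+1))) with hθ
  have hgen : ∀ i : Fin (m+1), ∀ h : G, Φ (θ (FreeGroup.of i)) (j h) = j (FreeGroup.of i * h) := by
    intro i h
    induction i using Fin.lastCases with
    | last =>
      have : θ (FreeGroup.of (Fin.last m)) = FreeGroup.of (Fin.last n) := by simp [hθ]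
      rw [this, hΦ2, hT]
    | cast i =>
      have : θ (FreeGroup.of (Fin.castSucc i)) = FreeGroup.map Fin.castSucc (u i) := by
        simp [hθ]
      rw [this, ← MonoidHom.comp_apply, hΦ1]
      simp only [j, map_mul, hρι, FreeGroup.lift_apply_of]
      have hι : ι (FreeGroup.of i) = FreeGroup.of (Fin.castSucc i) := FreeGroup.map.of
      rw [hι]
      ext
      · rfl
      · change (ι (ρ h))⁻¹ * h = (FreeGroup.of (Fin.castSucc i) * ι (ρ h))⁻¹ * (FreeGroup.of (Fin.castSucc i) * h)
        rw [mul_inv_rev, mul_assoc, inv_mul_cancel_left]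
  have hall : ∀ g h : G, Φ (θ g) (j h) = j (g * h) := by
    intro g
    induction g using FreeGroup.induction_on with
    | C1 => intro h; simp
    | of i => exact hgen i
    | inv_of i _ =>
      intro h
      rw [map_inv, map_inv, Equiv.Perm.inv_eq_iff_eq, hgen, mul_inv_cancel_left]
    | mul a b ha hb =>
      intro h
      rw [map_mul, map_mul, Equiv.Perm.mul_apply, hb, ha, mul_assoc]
  rw [injective_iff_map_eq_one]
  intro g hg
  have := hall g 1
  rw [hg, map_one, mul_one] at this
  exact (hj this).symm

theorem aux_ext' {Γ : Type*} [Group Γ] {m n : ℕ} (x : Fin m → Γ) (y : Fin n → Γ) (t : Γ)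
    (hx : Function.Injective (FreeGroup.lift x))
    (hxy : ∀ i, x i ∈ Subgroup.closure (Set.range y))
    (hy : Function.Injective (FreeGroup.lift (Fin.snoc y t : Fin (n+1) → Γ))) :
    Function.Injective (FreeGroup.lift (Fin.snoc x t : Fin (m+1) → Γ)) := by
  have : ∀ i, ∃ u, FreeGroup.lift y u = x i := by
    intro i
    have := hxy i
    rwa [← FreeGroup.range_lift_eq_closure] at this
  choose u hu using this
  have h1 : FreeGroup.lift x = (FreeGroup.lift y).comp (FreeGroup.lift u) := by
    ext i; simp [hu]
  have hu' : Function.Injective (FreeGroup.lift u) := by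
    rw [h1] at hx
    exact Function.Injective.of_comp hx
  have h2 : (FreeGroup.lift (Fin.snoc y t : Fin (n+1) → Γ)).comp (FreeGroup.map Fin.castSucc)
      = FreeGroup.lift y := by
    ext i; simp
  have h3 : FreeGroup.lift (Fin.snoc x t : Fin (m+1) → Γ) =
      (FreeGroup.lift (Fin.snoc y t : Fin (n+1) → Γ)).comp (FreeGroup.lift
      (Fin.snoc (fun i => FreeGroup.map Fin.castSucc (u i)) (FreeGroup.of (Fin.last n)) :
        Fin (m+1) → FreeGroup (Fin (n+1)))) := by
    ext i
    induction i using Fin.lastCases with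
    | last => simp
    | cast i =>
      have := DFunLike.congr_fun h2 (u i)
      rw [MonoidHom.comp_apply] at this
      simp only [MonoidHom.comp_apply, FreeGroup.lift_apply_of, Fin.snoc_castSucc]
      rw [this, hu]
  rw [h3]
  exact hy.comp (aux_ext u hu')

theorem aux_step {Γ : Type*} [Group Γ] {k : ℕ} (hfree : KFree Γ k) (S : Finset Γ)
    (hrank : (k : ℕ∞) ≤ subgroupRank (Subgroup.closure (S : Set Γ)))
    {m : ℕ} (hm : m < k) (x : Fin m → Γ) (hxS : ∀ i, x i ∈ S)
    (hx : Function.Injective (FreeGroup.lift x)) :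
    ∃ t ∈ S, Function.Injective (FreeGroup.lift (Fin.snoc x t : Fin (m+1) → Γ)) := by
  classical
  by_contra! hno
  have claim : ∀ T : Finset Γ, T ⊆ S → ∃ n ≤ m, ∃ y : Fin n → Γ,
      Subgroup.closure (Set.range y) = Subgroup.closure (Set.range x ∪ (T : Set Γ)) := by
    intro T
    induction T using Finset.induction_on with
    | empty => intro _; exact ⟨m, le_rfl, x, by simp⟩
    | insert t T _ ih =>
      intro hT
      obtain ⟨n, hn, y, hy⟩ := ih ((Finset.subset_insert _ _).trans hT)
      have hcl : Subgroup.closure (Set.range (Fin.snoc y t : Fin (n+1) → Γ))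
          = Subgroup.closure (Set.range x ∪ ((insert t T : Finset Γ) : Set Γ)) := by
        rw [Fin.range_snoc, Finset.coe_insert, Set.union_insert, Set.insert_eq, Set.insert_eq,
          Subgroup.closure_union, Subgroup.closure_union, hy]
      rcases aux_key hfree (by omega : n + 1 ≤ k) (Fin.snoc y t : Fin (n+1) → Γ) with h | h
      · exfalso
        refine hno t (hT (Finset.mem_insert_self _ _)) (aux_ext' x y t hx (fun i => ?_) h)
        rw [hy]
        exact Subgroup.subset_closure (Or.inl ⟨i, rfl⟩)
      · obtain ⟨p, hp, z, hz⟩ := h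
        exact ⟨p, by omega, z, hz.trans hcl⟩
  obtain ⟨n, hn, y, hy⟩ := claim S subset_rfl
  have : Set.range x ∪ (S : Set Γ) = S := by
    apply Set.union_eq_self_of_subset_left
    rintro _ ⟨i, rfl⟩
    exact hxS i
  rw [this] at hy
  rw [← hy] at hrank
  have := hrank.trans (aux_rank_le y)
  have : k ≤ n := by exact_mod_cast this
  omega

/-- If `Γ` is `k`-free (`k > 0`), `S` is a finite subset of `Γ` with `rank ⟨S⟩ ≥ k`, and
`x₀` is a nontrivial element of `S`, then there are elements `x₁, …, x_{k-1}` of `S` such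
that `x₀, x₁, …, x_{k-1}` are independent. -/
theorem exists_independent_in_finset {Γ : Type*} [Group Γ] (k : ℕ) (hk : 0 < k)
    (hfree : KFree Γ k) (S : Finset Γ)
    (hrank : (k : ℕ∞) ≤ subgroupRank (Subgroup.closure (S : Set Γ)))
    (x₀ : Γ) (hx₀S : x₀ ∈ S) (hx₀ : x₀ ≠ 1) :
    ∃ g : Fin k → Γ, g ⟨0, hk⟩ = x₀ ∧ (∀ i, g i ∈ S) ∧ Independent g := by
  have main : ∀ m, m + 1 ≤ k → ∃ g : Fin (m+1) → Γ, g 0 = x₀ ∧ (∀ i, g i ∈ S) ∧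
      Function.Injective (FreeGroup.lift g) := by
    intro m
    induction m with
    | zero =>
      intro h
      refine ⟨fun _ => x₀, rfl, fun _ => hx₀S, ?_⟩
      rcases aux_key hfree h (fun _ => x₀ : Fin (0+1) → Γ) with h | ⟨p, hp, z, hz⟩
      · exact h
      · exfalso
        obtain rfl : p = 0 := by omega
        apply hx₀
        have : x₀ ∈ Subgroup.closure (Set.range (fun _ => x₀ : Fin (0+1) → Γ)) :=
          Subgroup.subset_closure ⟨0, rfl⟩
        rw [← hz] at this
        simpa using this
    | succ m ih =>
      intro h
      obtain ⟨g, h0, hS, hg⟩ := ih (by omega)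
      obtain ⟨t, ht, hinj⟩ := aux_step hfree S hrank (by omega) g hS hg
      refine ⟨Fin.snoc g t, ?_, ?_, hinj⟩
      · rw [← Fin.castSucc_zero, Fin.snoc_castSucc, h0]
      · intro i
        induction i using Fin.lastCases with
        | last => simpa using ht
        | cast i => simpa using hS i
  obtain ⟨m, rfl⟩ : ∃ m, k = m + 1 := ⟨k - 1, by omega⟩
  exact main m le_rfl
end

section
/- Let A be a strongly closable subgroup of a group Γ. For any element x of Γ, the following conditions are equivalent: (1) x is A-admissible; (2) localrank(⟨A, x⟩) ≤ localrank(A); (3) the homomorphism ι_{A,x} : A ∗ ⟨t⟩ → Γ is non-injective. Moreover, every element of A is A-admissible. -/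
namespace AdmAux

/-- Free groups are residually finite. -/
theorem resid {α : Type*} (g : FreeGroup α) (hg : g ≠ 1) :
    ∃ (S : Finset (FreeGroup α)) (φ : FreeGroup α →* Equiv.Perm S), φ g ≠ 1 := by
  classical
  obtain ⟨L, rfl⟩ : ∃ L, FreeGroup.mk L = g := ⟨g.toWord, FreeGroup.mk_toWord⟩
  let S : Finset (FreeGroup α) := (L.tails.map FreeGroup.mk).toFinset
  have hS : ∀ s, s <:+ L → FreeGroup.mk s ∈ S := by
    intro s hs
    simp only [S, List.mem_toFinset, List.mem_map, List.mem_tails]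
    exact ⟨s, hs, rfl⟩
  let e : ∀ a : α, {x : S // FreeGroup.of a * x.1 ∈ S} ≃ {x : S // (FreeGroup.of a)⁻¹ * x.1 ∈ S} :=
    fun a =>
    { toFun := fun x => ⟨⟨FreeGroup.of a * x.1.1, x.2⟩, by simp⟩
      invFun := fun x => ⟨⟨(FreeGroup.of a)⁻¹ * x.1.1, x.2⟩, by simp⟩
      left_inv := fun x => by simp
      right_inv := fun x => by simp }
  let φ : FreeGroup α →* Equiv.Perm S := FreeGroup.lift fun a => (e a).extendSubtype
  have hφ : ∀ (a : α) (x : S) (h : FreeGroup.of a * x.1 ∈ S),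
      φ (FreeGroup.of a) x = ⟨FreeGroup.of a * x.1, h⟩ := by
    intro a x h
    simp only [φ, FreeGroup.lift_apply_of]
    rw [Equiv.extendSubtype_apply_of_mem (e a) x h]
    rfl
  have h1 : (1 : FreeGroup α) ∈ S := hS [] List.nil_suffix
  have key : ∀ s (hs : s <:+ L), φ (FreeGroup.mk s) ⟨1, h1⟩ = ⟨FreeGroup.mk s, hS s hs⟩ := by
    intro s
    induction s with
    | nil =>
      intro hs
      have : FreeGroup.mk ([] : List (α × Bool)) = 1 := rfl
      simp [this]
    | cons c s ih =>
      intro hs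
      have hs' : s <:+ L := (List.suffix_cons c s).trans hs
      obtain ⟨a, b⟩ := c
      have hm := hS _ hs
      cases b with
      | true =>
        have hc : FreeGroup.mk ((a, true) :: s) = FreeGroup.of a * FreeGroup.mk s := by
          simp [FreeGroup.of]
        simp only [hc] at hm ⊢
        rw [map_mul, Equiv.Perm.mul_apply, ih hs', hφ a ⟨_, hS s hs'⟩ hm]
      | false =>
        have hc : FreeGroup.mk ((a, false) :: s) = (FreeGroup.of a)⁻¹ * FreeGroup.mk s := by
          simp [FreeGroup.of, FreeGroup.invRev]
        simp only [hc] at hm ⊢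
        rw [map_mul, Equiv.Perm.mul_apply, ih hs', map_inv, Equiv.Perm.inv_eq_iff_eq,
          hφ a ⟨_, hm⟩ (by simpa using hS s hs')]
        simp
  refine ⟨S, φ, fun h => hg ?_⟩
  have := key L List.suffix_rfl
  rw [h] at this
  simpa using (congrArg Subtype.val this).symm

theorem hopf {ι : Type*} {n : ℕ} (f : FreeGroup (Fin n) →* FreeGroup ι)
    (hf : Function.Surjective f) :
    Finite ι ∧ (Nat.card ι < n ∨ Function.Injective f) := by
  classical
  have hinj : ∀ (Q : Type) [Group Q], Function.Injective
      (fun (p : ι → Q) (i : Fin n) => FreeGroup.lift p (f (FreeGroup.of i))) := by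
    intro Q _ p q h
    have : (FreeGroup.lift p).comp f = (FreeGroup.lift q).comp f := by
      ext i; exact congrFun h i
    have h2 : FreeGroup.lift p = FreeGroup.lift q := by
      ext i
      obtain ⟨y, hy⟩ := hf (FreeGroup.of i)
      rw [← hy]
      exact DFunLike.congr_fun this y
    exact FreeGroup.lift.injective h2
  let Q0 := Multiplicative (ZMod 2)
  have hi0 := hinj Q0
  have fin0 : Finite (Fin n → Q0) := by
    have : Finite Q0 := inferInstanceAs (Finite (ZMod 2))
    infer_instance
  have fin1 : Finite (ι → Q0) := Finite.of_injective _ hi0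
  have fin2 : Finite ι := by
    refine Finite.of_injective (fun i : ι => (Pi.mulSingle i (Multiplicative.ofAdd 1) : ι → Q0)) ?_
    intro i j h
    by_contra hij
    have := congrFun h i
    simp only [Pi.mulSingle_eq_same, Pi.mulSingle_eq_of_ne hij] at this
    revert this
    decide
  refine ⟨fin2, ?_⟩
  have hcard : Nat.card ι ≤ n := by
    have h := Nat.card_le_card_of_injective _ hi0
    have hQ : Nat.card Q0 = 2 := by
      change Nat.card (ZMod 2) = 2
      simp
    rw [Nat.card_fun, Nat.card_fun, hQ, Nat.card_fin] at h
    exact (Nat.pow_le_pow_iff_right (by norm_num)).1 h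
  rcases hcard.lt_or_eq with h | h
  · exact Or.inl h
  right
  rw [injective_iff_map_eq_one]
  intro g hg
  by_contra hne
  obtain ⟨S, φ, hφ⟩ := resid g hne
  have hiQ := hinj (Equiv.Perm S)
  have hb := (Nat.bijective_iff_injective_and_card _).2
    ⟨hiQ, by rw [Nat.card_fun, Nat.card_fun, h, Nat.card_fin]⟩
  obtain ⟨p, hp⟩ := hb.2 (fun i => φ (FreeGroup.of i))
  have : (FreeGroup.lift p).comp f = φ := by
    apply FreeGroup.ext_hom
    intro i
    exact congrFun hp i
  apply hφ
  rw [← this, MonoidHom.comp_apply, hg, map_one]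

/-- `H` is generated by `n` elements. -/
def Gen {Γ : Type*} [Group Γ] (H : Subgroup Γ) (n : ℕ) : Prop :=
  ∃ v : Fin n → Γ, Subgroup.closure (Set.range v) = H

theorem gen_of_finset {Γ : Type*} [Group Γ] (S : Finset Γ) {n : ℕ} (h : S.card ≤ n) :
    Gen (Subgroup.closure (S : Set Γ)) n := by
  let e := S.equivFin.symm
  refine ⟨fun i => if h : i.1 < S.card then (e ⟨i, h⟩ : Γ) else 1, ?_⟩
  apply le_antisymm
  · rw [Subgroup.closure_le]
    rintro _ ⟨i, rfl⟩
    dsimp only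
    split_ifs with hi
    · exact Subgroup.subset_closure (e ⟨i, hi⟩).2
    · exact one_mem _
  · apply Subgroup.closure_mono
    intro s hs
    refine ⟨⟨S.equivFin ⟨s, hs⟩, lt_of_lt_of_le (Fin.is_lt _) h⟩, ?_⟩
    simp [e]

theorem rank_le_iff {Γ : Type*} [Group Γ] (H : Subgroup Γ) (n : ℕ) :
    subgroupRank H ≤ n ↔ Gen H n := by
  classical
  constructor
  · intro h
    have h' : subgroupRank H < ((n + 1 : ℕ) : ℕ∞) :=
      lt_of_le_of_lt h (by exact_mod_cast Nat.lt_succ_self n)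
    unfold subgroupRank at h'
    simp only [iInf_lt_iff] at h'
    obtain ⟨S, hS, hc⟩ := h'
    have hc' : S.card ≤ n := Nat.lt_succ_iff.1 (by exact_mod_cast hc)
    exact hS ▸ gen_of_finset S hc'
  · rintro ⟨v, hv⟩
    refine (iInf₂_le (Finset.univ.image v) (by simpa using hv)).trans ?_
    have : (Finset.univ.image v).card ≤ n := by
      simpa using Finset.card_image_le (s := Finset.univ) (f := v)
    exact_mod_cast this

theorem gen_mono {Γ : Type*} [Group Γ] {H : Subgroup Γ} {m n : ℕ} (hmn : m ≤ n)
    (h : Gen H m) : Gen H n := by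
  rw [← rank_le_iff] at h ⊢
  exact h.trans (by exact_mod_cast hmn)

theorem localRankLE_mono {Γ : Type*} [Group Γ] {A : Subgroup Γ} {m n : ℕ} (hmn : m ≤ n)
    (h : LocalRankLE A m) : LocalRankLE A n := by
  intro B hB hfg
  obtain ⟨C, h1, h2, h3⟩ := h B hB hfg
  exact ⟨C, h1, h2, h3.trans (by exact_mod_cast hmn)⟩

theorem localRank_le_iff {Γ : Type*} [Group Γ] (A : Subgroup Γ) (n : ℕ) :
    localRank A ≤ n ↔ LocalRankLE A n := by
  constructor
  · intro h
    have h' : localRank A < ((n + 1 : ℕ) : ℕ∞) :=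
      lt_of_le_of_lt h (by exact_mod_cast Nat.lt_succ_self n)
    unfold localRank at h'
    simp only [iInf_lt_iff] at h'
    obtain ⟨m, hm, hc⟩ := h'
    exact localRankLE_mono (Nat.lt_succ_iff.1 (by exact_mod_cast hc)) hm
  · intro h
    exact iInf₂_le n h

/-- Generators of a free subgroup are either independent or redundant. -/
theorem key {Γ : Type*} [Group Γ] {H : Subgroup Γ} (hH : IsFreeGroup H) {n : ℕ} (v : Fin n → Γ)
    (hv : Subgroup.closure (Set.range v) = H) :
    Function.Injective (FreeGroup.lift v) ∨ ∃ m < n, Gen H m := by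
  classical
  have hr : (FreeGroup.lift v).range = H := by
    rw [FreeGroup.range_lift_eq_closure, hv]
  subst hr
  obtain ⟨ι, ⟨b⟩⟩ := hH.nonempty_basis
  let f : FreeGroup (Fin n) →* FreeGroup ι := b.repr.toMonoidHom.comp (FreeGroup.lift v).rangeRestrict
  have hf : Function.Surjective f :=
    b.repr.surjective.comp (FreeGroup.lift v).rangeRestrict_surjective
  obtain ⟨hfin, h | h⟩ := hopf f hf
  · right
    refine ⟨Nat.card ι, h, ?_⟩
    let e := (Finite.equivFin ι).symm
    refine ⟨fun i => (b (e i) : Γ), ?_⟩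
    have h1 : (FreeGroup.lift fun i => (b i : Γ)) =
        (Subgroup.subtype _).comp b.repr.symm.toMonoidHom := by
      apply FreeGroup.ext_hom
      intro i
      simp
      rfl
    have h2 : Set.range (fun i => (b (e i) : Γ)) = Set.range (fun i => (b i : Γ)) :=
      e.surjective.range_comp (fun i => (b i : Γ))
    have h3 : b.repr.symm.toMonoidHom.range = ⊤ :=
      MonoidHom.range_eq_top.2 b.repr.symm.surjective
    rw [h2, ← FreeGroup.range_lift_eq_closure, h1, MonoidHom.range_comp, h3,
      ← MonoidHom.range_eq_map,
      Subgroup.range_subtype]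
  · left
    intro x y hxy
    apply h
    have : (FreeGroup.lift v).rangeRestrict x = (FreeGroup.lift v).rangeRestrict y :=
      Subtype.ext hxy
    simp only [f, MonoidHom.comp_apply, this]

theorem range_iota {Γ : Type*} [Group Γ] (A : Subgroup Γ) (x : Γ) :
    (iotaAX A x).range = A ⊔ Subgroup.closure {x} := by
  rw [iotaAX, Monoid.Coprod.range_lift, Subgroup.range_subtype, ← Subgroup.zpowers_eq_closure]
  congr 1

theorem part2 {Γ : Type*} [Group Γ] {A : Subgroup Γ} {x : Γ} {r : ℕ} (hk : KFree Γ r)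
    (hL : LocalRankLE (A ⊔ Subgroup.closure {x}) r) (hi : Function.Injective (iotaAX A x))
    (B : Subgroup Γ) (hB : B ≤ A) (hfg : B.FG) :
    ∃ C : Subgroup Γ, C ≤ A ∧ B ≤ C ∧ ∃ m < r, Gen C m := by
  have hxfg : (Subgroup.closure {x} : Subgroup Γ).FG := ⟨{x}, by simp⟩
  obtain ⟨D, hD1, hD2, hD3⟩ := hL (B ⊔ Subgroup.closure {x}) (sup_le_sup_right hB _)
    (hfg.sup hxfg)
  obtain ⟨v, hv⟩ := (rank_le_iff _ _).1 hD3
  have hvw : ∀ i, ∃ w, iotaAX A x w = v i := by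
    intro i
    have : v i ∈ (iotaAX A x).range := by
      rw [range_iota]
      apply hD1
      rw [← hv]
      exact Subgroup.subset_closure ⟨i, rfl⟩
    exact this
  choose w hw using hvw
  let u : Fin r → Γ := fun i => ((Monoid.Coprod.fst (w i) : A) : Γ)
  let e := FreeGroup.lift w
  have e1 : ∀ y, iotaAX A x (e y) = FreeGroup.lift v y := by
    have : (iotaAX A x).comp e = FreeGroup.lift v := by
      apply FreeGroup.ext_hom
      intro i
      simp [e, hw]
    exact fun y => DFunLike.congr_fun this y
  have e2 : ∀ y, ((Monoid.Coprod.fst (e y) : A) : Γ) = FreeGroup.lift u y := by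
    have : (A.subtype.comp Monoid.Coprod.fst).comp e = FreeGroup.lift u := by
      apply FreeGroup.ext_hom
      intro i
      simp [e, u]
    exact fun y => DFunLike.congr_fun this y
  have hDr : ∀ d ∈ D, ∃ y, FreeGroup.lift v y = d := by
    intro d hd
    rw [← hv, ← FreeGroup.range_lift_eq_closure] at hd
    exact hd
  have hCrank : Gen (Subgroup.closure (Set.range u)) r := ⟨u, rfl⟩
  have hC : Subgroup.closure (Set.range u) ≤ A := by
    rw [Subgroup.closure_le]
    rintro _ ⟨i, rfl⟩
    exact (Monoid.Coprod.fst (w i) : A).2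
  refine ⟨Subgroup.closure (Set.range u), hC, ?_, ?_⟩
  · intro b hb
    obtain ⟨y, hy⟩ := hDr b (hD2 (Subgroup.mem_sup_left hb))
    have : e y = Monoid.Coprod.inl ⟨b, hB hb⟩ := by
      apply hi
      rw [e1, hy]
      simp [iotaAX]
    have h2 := e2 y
    rw [this, Monoid.Coprod.fst_apply_inl] at h2
    rw [← FreeGroup.range_lift_eq_closure]
    exact ⟨y, h2.symm⟩
  · rcases key (hk _ ((rank_le_iff _ _).2 hCrank)) u rfl with h | h
    · exfalso
      obtain ⟨y, hy⟩ := hDr x (hD2 (Subgroup.mem_sup_right (Subgroup.subset_closure rfl)))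
      have h1 : e y = Monoid.Coprod.inr (Multiplicative.ofAdd 1) := by
        apply hi
        rw [e1, hy]
        simp [iotaAX]
      have h2 := e2 y
      rw [h1, Monoid.Coprod.fst_apply_inr] at h2
      have hy1 : y = 1 := h (by rw [← h2]; simp)
      rw [hy1, map_one] at h1
      have h3 := congrArg Monoid.Coprod.snd h1
      rw [map_one, Monoid.Coprod.snd_apply_inr] at h3
      revert h3
      decide
    · exact h

theorem approx_mem {Γ : Type*} [Group Γ] {A : Subgroup Γ} {x : Γ} (y : Γ)
    (hy : y ∈ A ⊔ Subgroup.closure {x}) :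
    ∃ B : Subgroup Γ, B ≤ A ∧ B.FG ∧ y ∈ B ⊔ Subgroup.closure {x} := by
  have hAx : A ⊔ Subgroup.closure {x} = Subgroup.closure ((A : Set Γ) ∪ {x}) := by
    rw [Subgroup.closure_union, Subgroup.closure_eq]
  rw [hAx] at hy
  induction hy using Subgroup.closure_induction with
  | mem z hz =>
    rcases hz with hz | hz
    · exact ⟨Subgroup.closure {z}, by simpa using hz, ⟨{z}, by simp⟩,
        Subgroup.mem_sup_left (Subgroup.subset_closure rfl)⟩
    · exact ⟨⊥, bot_le, Subgroup.FG.bot, Subgroup.mem_sup_right (Subgroup.subset_closure hz)⟩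
  | one => exact ⟨⊥, bot_le, Subgroup.FG.bot, one_mem _⟩
  | mul a b _ _ ha hb =>
    obtain ⟨B, h1, h2, h3⟩ := ha
    obtain ⟨C, h4, h5, h6⟩ := hb
    have hl : B ⊔ Subgroup.closure {x} ≤ B ⊔ C ⊔ Subgroup.closure {x} :=
      sup_le_sup_right le_sup_left _
    have hr : C ⊔ Subgroup.closure {x} ≤ B ⊔ C ⊔ Subgroup.closure {x} :=
      sup_le_sup_right le_sup_right _
    exact ⟨B ⊔ C, sup_le h1 h4, h2.sup h5, mul_mem (hl h3) (hr h6)⟩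
  | inv a _ ha =>
    obtain ⟨B, h1, h2, h3⟩ := ha
    exact ⟨B, h1, h2, inv_mem h3⟩

theorem approx_fg {Γ : Type*} [Group Γ] {A : Subgroup Γ} {x : Γ} (D : Subgroup Γ)
    (hD : D ≤ A ⊔ Subgroup.closure {x}) (hfg : D.FG) :
    ∃ B : Subgroup Γ, B ≤ A ∧ B.FG ∧ D ≤ B ⊔ Subgroup.closure {x} := by
  classical
  obtain ⟨S, rfl⟩ := hfg
  simp only [Subgroup.closure_le] at hD ⊢
  induction S using Finset.induction_on with
  | empty => exact ⟨⊥, bot_le, Subgroup.FG.bot, by simp⟩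
  | insert a S _ ih =>
    rw [Finset.coe_insert, Set.insert_subset_iff] at hD
    obtain ⟨B, h1, h2, h3⟩ := ih hD.2
    obtain ⟨C, h4, h5, h6⟩ := approx_mem a hD.1
    refine ⟨B ⊔ C, sup_le h1 h4, h2.sup h5, ?_⟩
    rw [Finset.coe_insert, Set.insert_subset_iff]
    have hl : B ⊔ Subgroup.closure {x} ≤ B ⊔ C ⊔ Subgroup.closure {x} :=
      sup_le_sup_right le_sup_left _
    have hr : C ⊔ Subgroup.closure {x} ≤ B ⊔ C ⊔ Subgroup.closure {x} :=
      sup_le_sup_right le_sup_right _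
    exact ⟨hr h6, fun z hz => hl (h3 hz)⟩

theorem approx_word {Γ : Type*} [Group Γ] {A : Subgroup Γ}
    (w : Monoid.Coprod A (Multiplicative ℤ)) :
    ∃ B : Subgroup Γ, B ≤ A ∧ B.FG ∧ ∀ (C : Subgroup Γ) (hC : C ≤ A), B ≤ C →
      ∃ w' : Monoid.Coprod C (Multiplicative ℤ),
        Monoid.Coprod.map (Subgroup.inclusion hC) (MonoidHom.id _) w' = w := by
  induction w using Monoid.Coprod.induction_on with
  | inl a =>
    refine ⟨Subgroup.closure {a.1}, by simp, ⟨{a.1}, by simp⟩, fun C hC hBC => ?_⟩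
    exact ⟨Monoid.Coprod.inl ⟨a.1, hBC (Subgroup.subset_closure rfl)⟩, rfl⟩
  | inr n => exact ⟨⊥, bot_le, Subgroup.FG.bot, fun C hC _ => ⟨Monoid.Coprod.inr n, rfl⟩⟩
  | mul a b ha hb =>
    obtain ⟨B, h1, h2, h3⟩ := ha
    obtain ⟨B', h4, h5, h6⟩ := hb
    refine ⟨B ⊔ B', sup_le h1 h4, h2.sup h5, fun C hC hBC => ?_⟩
    obtain ⟨w1, hw1⟩ := h3 C hC (le_sup_left.trans hBC)
    obtain ⟨w2, hw2⟩ := h6 C hC (le_sup_right.trans hBC)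
    exact ⟨w1 * w2, by rw [map_mul, hw1, hw2]⟩

theorem closure_snoc {Γ : Type*} [Group Γ] {r : ℕ} (v : Fin r → Γ) (x : Γ) :
    Subgroup.closure (Set.range (Fin.cons x v : Fin (r + 1) → Γ)) =
      Subgroup.closure (Set.range v) ⊔ Subgroup.closure {x} := by
  rw [Fin.range_cons, Set.insert_eq, Subgroup.closure_union, sup_comm]

theorem iota_inj {Γ : Type*} [Group Γ] {C : Subgroup Γ} {x : Γ} {r : ℕ} (v : Fin r → Γ)
    (hv : Subgroup.closure (Set.range v) = C)
    (hi : Function.Injective (FreeGroup.lift (Fin.cons x v : Fin (r + 1) → Γ))) :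
    Function.Injective (iotaAX C x) := by
  have hvC : ∀ i, v i ∈ C := fun i => hv ▸ Subgroup.subset_closure ⟨i, rfl⟩
  let q : FreeGroup (Fin (r + 1)) →* Monoid.Coprod C (Multiplicative ℤ) :=
    FreeGroup.lift (Fin.cons (Monoid.Coprod.inr (Multiplicative.ofAdd 1))
      fun i => Monoid.Coprod.inl ⟨v i, hvC i⟩)
  have hq : (iotaAX C x).comp q = FreeGroup.lift (Fin.cons x v : Fin (r + 1) → Γ) := by
    apply FreeGroup.ext_hom
    intro i
    refine Fin.cases ?_ (fun i => ?_) i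
    · simp [q, iotaAX]
    · simp [q, iotaAX]
  have hs : Function.Surjective q := by
    rw [← MonoidHom.range_eq_top, eq_top_iff, ← Monoid.Coprod.range_inl_sup_range_inr]
    apply sup_le
    · rintro _ ⟨c, rfl⟩
      have hc : c.1 ∈ (FreeGroup.lift v).range := by
        rw [FreeGroup.range_lift_eq_closure, hv]; exact c.2
      obtain ⟨y, hy⟩ := hc
      refine ⟨FreeGroup.map Fin.succ y, ?_⟩
      let p : FreeGroup (Fin r) →* C := FreeGroup.lift fun i => ⟨v i, hvC i⟩
      have hp : C.subtype.comp p = FreeGroup.lift v := by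
        apply FreeGroup.ext_hom
        intro i
        simp [p]
      have hpc : p y = c := Subtype.ext ((DFunLike.congr_fun hp y).trans hy)
      have h2 : q.comp (FreeGroup.map Fin.succ) = Monoid.Coprod.inl.comp p := by
        apply FreeGroup.ext_hom
        intro i
        simp [p, q]
      rw [← hpc]
      exact DFunLike.congr_fun h2 y
    · rintro _ ⟨n, rfl⟩
      refine ⟨FreeGroup.of 0 ^ (Multiplicative.toAdd n), ?_⟩
      simp only [q, map_zpow, FreeGroup.lift_apply_of, Fin.cons_zero]
      rw [← map_zpow, ← ofAdd_zsmul]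
      simp
  intro a b hab
  obtain ⟨a, rfl⟩ := hs a
  obtain ⟨b, rfl⟩ := hs b
  congr 1
  apply hi
  rw [← hq]
  exact hab

theorem part1 {Γ : Type*} [Group Γ] {A : Subgroup Γ} {x : Γ} {r : ℕ} (hk : KFree Γ (r + 1))
    (hL : LocalRankLE A r) (hi : ¬ Function.Injective (iotaAX A x)) :
    LocalRankLE (A ⊔ Subgroup.closure {x}) r := by
  rw [injective_iff_map_eq_one] at hi
  push Not at hi
  obtain ⟨w, hw, hw1⟩ := hi
  obtain ⟨B0, h01, h02, h03⟩ := approx_word w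
  intro B hB hfg
  obtain ⟨B1, h11, h12, h13⟩ := approx_fg B hB hfg
  obtain ⟨C, hC1, hC2, hC3⟩ := hL (B0 ⊔ B1) (sup_le h01 h11) (h02.sup h12)
  obtain ⟨v, hv⟩ := (rank_le_iff _ _).1 hC3
  refine ⟨C ⊔ Subgroup.closure {x}, sup_le_sup_right hC1 _,
    h13.trans (sup_le_sup_right (le_sup_right.trans hC2) _), ?_⟩
  rw [rank_le_iff]
  have hcl : Subgroup.closure (Set.range (Fin.cons x v : Fin (r + 1) → Γ)) =
      C ⊔ Subgroup.closure {x} := by rw [closure_snoc, hv]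
  rcases key (hk _ ((rank_le_iff _ _).2 ⟨_, hcl⟩)) _ hcl with h | ⟨m, hm, h⟩
  · exfalso
    have hinj := iota_inj v hv h
    obtain ⟨w', hw'⟩ := h03 C hC1 (le_sup_left.trans hC2)
    have hcomp : (iotaAX A x).comp
        (Monoid.Coprod.map (Subgroup.inclusion hC1) (MonoidHom.id _)) = iotaAX C x := by
      apply Monoid.Coprod.hom_ext
      · rfl
      · rfl
    have : iotaAX C x w' = 1 := by
      rw [← hcomp, MonoidHom.comp_apply, hw', hw]
    have hw'1 : w' = 1 := hinj (by rw [this, map_one])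
    rw [hw'1, map_one] at hw'
    exact hw1 hw'.symm
  · exact gen_mono (Nat.lt_succ_iff.1 hm) h

theorem kfree_mono {Γ : Type*} [Group Γ] {m n : ℕ} (hmn : m ≤ n) (h : KFree Γ n) : KFree Γ m :=
  fun H hH => h H (hH.trans (by exact_mod_cast hmn))

theorem main {Γ : Type*} [Group Γ] (A : Subgroup Γ) (hA : StronglyClosable A) (x : Γ) :
    localRank (A ⊔ Subgroup.closure {x}) ≤ localRank A ↔ ¬ Function.Injective (iotaAX A x) := by
  have hA' := hA
  unfold StronglyClosable iof at hA'
  simp only [lt_iSup_iff] at hA'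
  obtain ⟨k, hk, hlt⟩ := hA'
  obtain ⟨r, hr⟩ := ENat.ne_top_iff_exists.1 (ne_top_of_lt hlt)
  have hL : LocalRankLE A r := (localRank_le_iff _ _).1 hr.ge
  rw [← hr] at hlt ⊢
  have hrk : r < k := by exact_mod_cast hlt
  rw [localRank_le_iff]
  constructor
  · intro h hi
    have h2 := part2 (kfree_mono hrk.le hk) h hi
    obtain ⟨_, _, _, m, hm, _⟩ := h2 ⊥ bot_le Subgroup.FG.bot
    have h3 : LocalRankLE A (r - 1) := by
      intro B hB hfg
      obtain ⟨C, hC1, hC2, m, hm, hC⟩ := h2 B hB hfg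
      exact ⟨C, hC1, hC2, (rank_le_iff _ _).2 (gen_mono (by omega) hC)⟩
    rw [← localRank_le_iff, ← hr] at h3
    have : r ≤ r - 1 := by exact_mod_cast h3
    omega
  · exact part1 (kfree_mono hrk hk) hL

end AdmAux

/-- For a strongly closable subgroup `A` and any `x ∈ Γ`, the following are equivalent:
`x` is `A`-admissible; `localRank ⟨A,x⟩ ≤ localRank A`; and `ι_{A,x}` is non-injective.
Moreover every element of `A` is `A`-admissible. -/
theorem admissible_tfae {Γ : Type*} [Group Γ] (A : Subgroup Γ) (hA : StronglyClosable A) :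
    (∀ x : Γ,
      (Admissible A x ↔ localRank (A ⊔ Subgroup.closure {x}) ≤ localRank A) ∧
      (Admissible A x ↔ ¬ Function.Injective (iotaAX A x))) ∧
    (∀ a ∈ A, Admissible A a) := by
  have h12 : ∀ x : Γ, Admissible A x ↔ localRank (A ⊔ Subgroup.closure {x}) ≤ localRank A :=
    fun x => ⟨fun h => h.2, fun h => ⟨lt_of_le_of_lt h hA, h⟩⟩
  refine ⟨fun x => ⟨h12 x, (h12 x).trans (AdmAux.main A hA x)⟩, fun a ha => (h12 a).2 ?_⟩
  have : A ⊔ Subgroup.closure {a} = A := sup_eq_left.2 (by simpa using ha)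
  rw [this]
end

section
/- Let A and B be subgroups of a group Γ. Suppose that localrank(B) < ∞, that B ≤ A, and that A is strongly closable. Then every B-admissible sequence in Γ is also A-admissible. -/
universe u in
theorem aux_resFin {ι : Type u} (w : FreeGroup ι) (hw : w ≠ 1) :
    ∃ (V : Type u) (_ : Finite V) (f : FreeGroup ι →* Equiv.Perm V), f w ≠ 1 := by
  classical
  obtain ⟨L, rfl⟩ : ∃ L, FreeGroup.mk L = w := ⟨w.toWord, FreeGroup.mk_toWord⟩
  let V : Set (FreeGroup ι) := FreeGroup.mk '' {s | s ∈ L.tails}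
  have hV : V.Finite := (List.finite_toSet _).image _
  have : Finite V := hV
  have hσ : ∀ a : ι, ∃ σ : Equiv.Perm V, ∀ v v' : V,
      FreeGroup.of a * (v : FreeGroup ι) = v' → σ v = v' := by
    intro a
    obtain ⟨σ, hσ⟩ := Equiv.Perm.exists_extending_pair
      (α := {v : V // FreeGroup.of a * (v : FreeGroup ι) ∈ V}) (β := V)
      (fun v => v.1) (fun v => ⟨_, v.2⟩) Subtype.val_injective (by
        intro v v' h
        have := congrArg Subtype.val h
        exact Subtype.ext (Subtype.ext (mul_left_cancel this)))
    refine ⟨σ, fun v v' h => ?_⟩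
    have := hσ ⟨v, by rw [h]; exact v'.2⟩
    simp only at this
    rw [this]
    exact Subtype.ext h
  choose σ hσ using hσ
  have hmem : ∀ s, s <:+ L → FreeGroup.mk s ∈ V := fun s hs => ⟨s, by simpa using hs, rfl⟩
  have h1 : (1 : FreeGroup ι) ∈ V := hmem [] (List.nil_suffix)
  have key : ∀ s (hs : s <:+ L),
      (FreeGroup.lift σ (FreeGroup.mk s)) ⟨1, h1⟩ = ⟨FreeGroup.mk s, hmem s hs⟩ := by
    intro s
    induction s with
    | nil => intro hs; rfl
    | cons p s ih =>
      intro hs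
      have hs' : s <:+ L := (List.suffix_cons p s).trans hs
      have e : FreeGroup.mk (p :: s) = FreeGroup.mk [p] * FreeGroup.mk s := by
        rw [FreeGroup.mul_mk]; rfl
      have : FreeGroup.lift σ (FreeGroup.mk (p :: s)) =
          FreeGroup.lift σ (FreeGroup.mk [p]) * FreeGroup.lift σ (FreeGroup.mk s) := by
        rw [e, map_mul]
      rw [this, Equiv.Perm.mul_apply, ih hs']
      obtain ⟨a, b⟩ := p
      cases b with
      | true =>
        have e2 : FreeGroup.lift σ (FreeGroup.mk [(a, true)]) = σ a := FreeGroup.lift_apply_of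
        rw [e2]
        exact hσ a _ _ e.symm
      | false =>
        have e3 : FreeGroup.mk [(a, false)] = (FreeGroup.of a)⁻¹ := rfl
        have e2 : FreeGroup.lift σ (FreeGroup.mk [(a, false)]) = (σ a)⁻¹ := by
          rw [e3, map_inv, FreeGroup.lift_apply_of]
        rw [e2, Equiv.Perm.inv_eq_iff_eq]
        symm
        apply hσ
        simp only
        rw [e, e3, mul_inv_cancel_left]
  refine ⟨↥V, inferInstance, FreeGroup.lift σ, fun h => hw ?_⟩
  have := key L List.suffix_rfl
  rw [h] at this
  exact (congrArg Subtype.val this).symm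

theorem aux_hopf_s6 {ι : Type*} [Fintype ι] {G : Type*} [Group G] [IsFreeGroup G]
    (φ : FreeGroup ι →* G) (hs : Function.Surjective φ) (hi : ¬ Function.Injective φ) :
    ∃ T : Finset G, T.card < Fintype.card ι ∧ Subgroup.closure (T : Set G) = ⊤ := by
  classical
  rw [injective_iff_map_eq_one] at hi
  push Not at hi
  obtain ⟨w, hw, hw1⟩ := hi
  obtain ⟨V, hV, f, hf⟩ := aux_resFin w hw1
  let Q := Equiv.Perm V
  have : Finite Q := inferInstanceAs (Finite (Equiv.Perm V))
  have : Nontrivial Q := ⟨_, _, hf⟩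
  let b := IsFreeGroup.basis G
  let X := IsFreeGroup.Generators G
  let F : (X → Q) → (ι → Q) := fun u => FreeGroup.lift.symm ((b.lift u).comp φ)
  have hF : Function.Injective F := by
    intro u v h
    have h2 := FreeGroup.lift.symm.injective h
    apply b.lift.injective
    refine MonoidHom.ext fun g => ?_
    obtain ⟨y, rfl⟩ := hs g
    exact DFunLike.congr_fun h2 y
  have hFs : ¬ Function.Surjective F := by
    intro h
    obtain ⟨u, hu⟩ := h (FreeGroup.lift.symm f)
    have h2 := FreeGroup.lift.symm.injective hu
    apply hf
    rw [← h2, MonoidHom.comp_apply, hw, map_one]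
  have : Finite (X → Q) := Finite.of_injective F hF
  have : Finite X := by
    obtain ⟨q, q', hq⟩ := exists_pair_ne Q
    refine Finite.of_injective (fun x : X => fun y : X => if x = y then q else q') ?_
    intro x y h
    by_contra hne
    have := congrFun h x
    simp [Ne.symm hne] at this
    exact hq this
  have := Fintype.ofFinite X
  have := Fintype.ofFinite Q
  have hlt : Fintype.card (X → Q) < Fintype.card (ι → Q) :=
    Fintype.card_lt_of_injective_not_surjective F hF hFs
  rw [Fintype.card_fun, Fintype.card_fun] at hlt
  have hlt' := (Nat.pow_lt_pow_iff_right Fintype.one_lt_card).1 hlt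
  refine ⟨Finset.univ.image b, lt_of_le_of_lt Finset.card_image_le (by simpa using hlt'), ?_⟩
  simp only [Finset.coe_image, Finset.coe_univ, Set.image_univ]
  have : (b : X → G) = (b.repr.symm : FreeGroup X → G) ∘ FreeGroup.of := by
    ext x; rfl
  rw [this, Set.range_comp]
  have := MonoidHom.map_closure b.repr.symm.toMonoidHom (Set.range (FreeGroup.of : X → _))
  rw [FreeGroup.closure_range_of] at this
  refine Eq.trans this.symm ?_
  rw [← MonoidHom.range_eq_map, MonoidHom.range_eq_top]
  exact b.repr.symm.surjective

theorem aux_rank_le_s6 {Γ : Type*} [Group Γ] {H : Subgroup Γ} {n : ℕ} :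
    subgroupRank H ≤ n ↔ ∃ S : Finset Γ, S.card ≤ n ∧ Subgroup.closure (S : Set Γ) = H := by
  constructor
  · intro h
    have h' : subgroupRank H < ((n + 1 : ℕ) : ℕ∞) :=
      lt_of_le_of_lt h (by exact_mod_cast Nat.lt_succ_self n)
    unfold subgroupRank at h'
    simp only [iInf_lt_iff] at h'
    obtain ⟨S, hS, hc⟩ := h'
    exact ⟨S, Nat.lt_succ_iff.1 (by exact_mod_cast hc), hS⟩
  · rintro ⟨S, hc, hS⟩
    exact (iInf₂_le S hS).trans (by exact_mod_cast hc)

theorem aux_rank_lt {Γ : Type*} [Group Γ] {ι : Type*} [Fintype ι] (H : Subgroup Γ)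
    [IsFreeGroup H] (φ : FreeGroup ι →* Γ) (hr : φ.range = H) (hi : ¬ Function.Injective φ) :
    ∃ T : Finset Γ, T.card < Fintype.card ι ∧ Subgroup.closure (T : Set Γ) = H := by
  classical
  subst hr
  obtain ⟨T, hT, hc⟩ := aux_hopf_s6 φ.rangeRestrict φ.rangeRestrict_surjective
    (fun h => hi (by
      intro a b hab
      exact h (Subtype.ext hab)))
  refine ⟨T.image Subtype.val, lt_of_le_of_lt Finset.card_image_le hT, ?_⟩
  have := MonoidHom.map_closure φ.range.subtype (T : Set φ.range)
  rw [hc, ← MonoidHom.range_eq_map, Subgroup.range_subtype] at this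
  refine Eq.trans ?_ this.symm
  simp

theorem aux_localRank {Γ : Type*} [Group Γ] {A : Subgroup Γ} (h : localRank A < ⊤) :
    ∃ r : ℕ, localRank A = r ∧ LocalRankLE A r := by
  obtain ⟨r, hr⟩ := ENat.ne_top_iff_exists.1 h.ne
  refine ⟨r, hr.symm, ?_⟩
  have h' : localRank A < ((r + 1 : ℕ) : ℕ∞) := by
    rw [← hr]; exact_mod_cast Nat.lt_succ_self r
  unfold localRank at h'
  simp only [iInf_lt_iff] at h'
  obtain ⟨q, hq, hc⟩ := h'
  intro B hB hf
  obtain ⟨C, h1, h2, h3⟩ := hq B hB hf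
  refine ⟨C, h1, h2, h3.trans ?_⟩
  have : q < r + 1 := by exact_mod_cast hc
  exact_mod_cast Nat.lt_succ_iff.1 this

theorem aux_localRank_le {Γ : Type*} [Group Γ] {A : Subgroup Γ} {r : ℕ} (h : LocalRankLE A r) :
    localRank A ≤ r := iInf₂_le r h

theorem aux_free {Γ : Type*} [Group Γ] {r : ℕ} (h : (r : ℕ∞) < iof Γ) : KFree Γ (r + 1) := by
  unfold iof at h
  simp only [lt_iSup_iff] at h
  obtain ⟨k, hk, hc⟩ := h
  intro H hH
  have : r < k := by exact_mod_cast hc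
  exact hk H (hH.trans (by exact_mod_cast this))

theorem aux_range {Γ : Type*} [Group Γ] (S : Finset Γ) :
    (FreeGroup.lift (fun s : S => (s : Γ))).range = Subgroup.closure (S : Set Γ) := by
  rw [FreeGroup.range_lift_eq_closure]; simp

theorem aux_fg_sup {Γ : Type*} [Group Γ] {A B : Subgroup Γ} (hA : A.FG) (hB : B.FG) :
    (A ⊔ B).FG := by
  classical
  obtain ⟨S, rfl⟩ := hA
  obtain ⟨T, rfl⟩ := hB
  exact ⟨S ∪ T, by rw [Finset.coe_union, Subgroup.closure_union]⟩

theorem aux_fg {Γ : Type*} [Group Γ] (A : Subgroup Γ) (x : Γ) (F : Subgroup Γ)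
    (hF : F ≤ A ⊔ Subgroup.closure {x}) (hfg : F.FG) :
    ∃ A₁ : Subgroup Γ, A₁ ≤ A ∧ A₁.FG ∧ F ≤ A₁ ⊔ Subgroup.closure {x} := by
  classical
  have one : ∀ y ∈ A ⊔ Subgroup.closure {x}, ∃ A₁ : Subgroup Γ, A₁ ≤ A ∧ A₁.FG ∧
      y ∈ A₁ ⊔ Subgroup.closure {x} := by
    intro y hy
    have e : A ⊔ Subgroup.closure {x} = Subgroup.closure ((A : Set Γ) ∪ {x}) := by
      rw [Subgroup.closure_union, Subgroup.closure_eq]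
    rw [e] at hy
    induction hy using Subgroup.closure_induction with
    | mem y hy =>
      rcases hy with hy | hy
      · exact ⟨Subgroup.closure {y}, by simpa using hy, ⟨{y}, by simp⟩,
          Subgroup.mem_sup_left (Subgroup.mem_closure_singleton_self y)⟩
      · exact ⟨⊥, bot_le, ⟨∅, by simp⟩, Subgroup.mem_sup_right (Subgroup.subset_closure hy)⟩
    | one => exact ⟨⊥, bot_le, ⟨∅, by simp⟩, one_mem _⟩
    | mul a b _ _ ha hb =>
      obtain ⟨P, h1, h2, h3⟩ := ha
      obtain ⟨Q, h1', h2', h3'⟩ := hb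
      exact ⟨P ⊔ Q, sup_le h1 h1', aux_fg_sup h2 h2', mul_mem
        (sup_le_sup_right (le_sup_left : P ≤ P ⊔ Q) _ h3)
        (sup_le_sup_right (le_sup_right : Q ≤ P ⊔ Q) _ h3')⟩
    | inv a _ ha =>
      obtain ⟨P, h1, h2, h3⟩ := ha
      exact ⟨P, h1, h2, inv_mem h3⟩
  obtain ⟨S, rfl⟩ := hfg
  rw [Subgroup.closure_le] at hF
  simp only [Subgroup.closure_le]
  induction S using Finset.induction_on with
  | empty => exact ⟨⊥, bot_le, ⟨∅, by simp⟩, by simp⟩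
  | insert a s _ ih =>
    rw [Finset.coe_insert, Set.insert_subset_iff] at hF
    obtain ⟨P, h1, h2, h3⟩ := one a hF.1
    obtain ⟨Q, h1', h2', h3'⟩ := ih hF.2
    refine ⟨P ⊔ Q, sup_le h1 h1', aux_fg_sup h2 h2', ?_⟩
    rw [Finset.coe_insert, Set.insert_subset_iff]
    exact ⟨sup_le_sup_right (le_sup_left : P ≤ P ⊔ Q) _ h3,
      h3'.trans (sup_le_sup_right (le_sup_right : Q ≤ P ⊔ Q) _)⟩

/-- Either `⟨A₂, x⟩` has rank at most `r`, or it retracts to `A₂` killing `x`. -/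
theorem aux_dichotomy {Γ : Type*} [Group Γ] {r : ℕ} (hfree : KFree Γ (r + 1)) (A : Subgroup Γ)
    (hA : subgroupRank A ≤ r) (x : Γ) :
    subgroupRank (A ⊔ Subgroup.closure {x}) ≤ r ∨
      ∃ π : ↥(A ⊔ Subgroup.closure {x}) →* Γ,
        (∀ g : ↥(A ⊔ Subgroup.closure {x}), (g : Γ) ∈ A → π g = g) ∧
          ∀ g : ↥(A ⊔ Subgroup.closure {x}), (g : Γ) = x → π g = 1 := by
  classical
  obtain ⟨S, hc, rfl⟩ := aux_rank_le_s6.1 hA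
  set G := Subgroup.closure (S : Set Γ) ⊔ Subgroup.closure {x} with hG
  have hGr : subgroupRank G ≤ ((r + 1 : ℕ) : ℕ∞) := by
    rw [aux_rank_le_s6]
    refine ⟨insert x S, (Finset.card_insert_le _ _).trans (by omega), ?_⟩
    rw [Finset.coe_insert, Set.insert_eq, Subgroup.closure_union, sup_comm]
  have := hfree G hGr
  let φ : FreeGroup (Option S) →* Γ := FreeGroup.lift (fun o => o.elim x (fun s => (s : Γ)))
  have hφ : φ.range = G := by
    rw [FreeGroup.range_lift_eq_closure, hG, ← Subgroup.closure_union]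
    congr 1
    ext y
    simp only [Set.mem_range, Option.exists, Option.elim, Set.mem_union, Set.mem_singleton_iff]
    constructor
    · rintro (h | ⟨s, rfl⟩)
      · exact Or.inr h.symm
      · exact Or.inl s.2
    · rintro (h | h)
      · exact Or.inr ⟨⟨y, h⟩, rfl⟩
      · exact Or.inl h.symm
  by_cases hi : Function.Injective φ
  · right
    rw [← hφ]
    let e := MonoidHom.ofInjective hi
    let ψ : FreeGroup (Option S) →* Γ := FreeGroup.lift (fun o => o.elim 1 (fun s => (s : Γ)))
    refine ⟨ψ.comp e.symm.toMonoidHom, ?_, ?_⟩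
    · intro g hg
      rw [← aux_range] at hg
      obtain ⟨u, hu⟩ := hg
      have h1 : φ (FreeGroup.map some u) = g := by
        rw [← hu]
        have : φ.comp (FreeGroup.map some) = FreeGroup.lift (fun s : S => (s : Γ)) := by
          ext s; simp [φ]
        exact DFunLike.congr_fun this u
      have h2 : ψ (FreeGroup.map some u) = g := by
        rw [← hu]
        have : ψ.comp (FreeGroup.map some) = FreeGroup.lift (fun s : S => (s : Γ)) := by
          ext s; simp [ψ]
        exact DFunLike.congr_fun this u
      have h3 : e.symm g = FreeGroup.map some u := by
        rw [MulEquiv.symm_apply_eq]; exact Subtype.ext h1.symm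
      change ψ (e.symm g) = g
      rw [h3, h2]
    · intro g hg
      have h3 : e.symm g = FreeGroup.of none := by
        rw [MulEquiv.symm_apply_eq]; exact Subtype.ext (by
          rw [hg]
          change x = φ (FreeGroup.of none)
          simp [φ])
      change ψ (e.symm g) = 1
      rw [h3]; simp [ψ]
  · left
    obtain ⟨T, hT, hTc⟩ := aux_rank_lt G φ hφ hi
    rw [aux_rank_le_s6]
    refine ⟨T, ?_, hTc⟩
    simp at hT
    omega

theorem aux_step_s6 {Γ : Type*} [Group Γ] (A B : Subgroup Γ)
    (hB : localRank B < ⊤) (hBA : B ≤ A) (hA : StronglyClosable A)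
    (x : Γ) (h : Admissible B x) : Admissible A x := by
  classical
  suffices hle : localRank (A ⊔ Subgroup.closure {x}) ≤ localRank A from
    ⟨lt_of_le_of_lt hle hA, hle⟩
  obtain ⟨r, hr, hAr⟩ := aux_localRank (lt_of_lt_of_le hA le_top)
  obtain ⟨s, hs, hBs⟩ := aux_localRank hB
  obtain ⟨t, ht, hBt⟩ := aux_localRank (lt_of_lt_of_le h.1 le_top)
  have hts : t ≤ s := by
    have := h.2
    rw [ht, hs] at this
    exact_mod_cast this
  have hfree := aux_free (r := r) (by rw [← hr]; exact hA)
  have hfreet := aux_free (r := t) (by rw [← ht]; exact h.1)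
  by_cases hx : x = 1
  · subst hx
    simp
  -- choose `B₀`
  obtain ⟨B₀, hB₀, hB₀fg, hmin⟩ : ∃ B₀ ≤ B, B₀.FG ∧
      ∀ C ≤ B, B₀ ≤ C → ∀ n : ℕ, subgroupRank C ≤ n → s ≤ n := by
    rcases Nat.eq_zero_or_pos s with h0 | h0
    · exact ⟨⊥, bot_le, ⟨∅, by simp⟩, fun _ _ _ n _ => by omega⟩
    · have : ¬ LocalRankLE B (s - 1) := by
        intro hh
        have := aux_localRank_le hh
        rw [hs] at this
        have : s ≤ s - 1 := by exact_mod_cast this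
        omega
      unfold LocalRankLE at this
      push Not at this
      obtain ⟨B₀, h1, h2, h3⟩ := this
      refine ⟨B₀, h1, h2, fun C hC hBC n hn => ?_⟩
      by_contra hlt
      refine absurd (hn.trans ?_) (not_le.2 (h3 C hC hBC))
      have : n ≤ s - 1 := by omega
      exact_mod_cast this
  obtain ⟨C, hC, hBC, hCt⟩ := hBt (B₀ ⊔ Subgroup.closure {x}) (sup_le_sup_right hB₀ _)
    (aux_fg_sup hB₀fg ⟨{x}, by simp⟩)
  have hCfg : C.FG := by
    obtain ⟨S, _, hS⟩ := aux_rank_le_s6.1 hCt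
    exact ⟨S, hS⟩
  obtain ⟨B₁, hB₁, hB₁fg, hCB₁⟩ := aux_fg B x C hC hCfg
  rw [hr]
  apply aux_localRank_le
  intro F hF hFfg
  obtain ⟨A₁, hA₁, hA₁fg, hFA₁⟩ := aux_fg A x F hF hFfg
  obtain ⟨A₂, hA₂, hA₁₂, hA₂r⟩ := hAr (A₁ ⊔ (B₀ ⊔ B₁))
    (sup_le hA₁ (sup_le (hB₀.trans hBA) (hB₁.trans hBA)))
    (aux_fg_sup hA₁fg (aux_fg_sup hB₀fg hB₁fg))
  have hA₁2 : A₁ ≤ A₂ := le_sup_left.trans hA₁₂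
  have hB₀2 : B₀ ≤ A₂ := (le_sup_left.trans le_sup_right).trans hA₁₂
  have hB₁2 : B₁ ≤ A₂ := (le_sup_right.trans le_sup_right).trans hA₁₂
  refine ⟨A₂ ⊔ Subgroup.closure {x}, sup_le_sup_right hA₂ _,
    hFA₁.trans (sup_le_sup_right hA₁2 _), ?_⟩
  rcases aux_dichotomy hfree A₂ hA₂r x with hgood | ⟨π, hπ1, hπ2⟩
  · exact hgood
  exfalso
  -- the image of `C` under `π`
  have hCG : C ≤ A₂ ⊔ Subgroup.closure {x} := hCB₁.trans (sup_le_sup_right hB₁2 _)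
  obtain ⟨S, hScard, hS⟩ := aux_rank_le_s6.1 hCt
  let ρ : C →* Γ := π.comp (Subgroup.inclusion hCG)
  let α : FreeGroup S →* Γ := FreeGroup.lift (fun s : S => (s : Γ))
  have hα : α.range = C := by rw [← hS]; exact aux_range S
  let β : FreeGroup S →* C := α.codRestrict C (fun u => hα ▸ ⟨u, rfl⟩)
  have hβ : Function.Surjective β := by
    rintro ⟨c, hc⟩
    rw [← hα] at hc
    obtain ⟨u, hu⟩ := hc
    exact ⟨u, Subtype.ext hu⟩
  let φ : FreeGroup S →* Γ := ρ.comp β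
  have hrange : φ.range = Subgroup.closure ((Finset.univ.image (fun s : S => φ (FreeGroup.of s)) : Finset Γ) : Set Γ) := by
    have : φ = FreeGroup.lift (fun s : S => φ (FreeGroup.of s)) := by ext s; simp
    conv_lhs => rw [this, FreeGroup.range_lift_eq_closure]
    simp
  have : IsFreeGroup φ.range := by
    apply hfreet
    rw [aux_rank_le_s6]
    refine ⟨_, Finset.card_image_le.trans ?_, hrange.symm⟩
    simp; omega
  have hxC : x ∈ C := hBC (Subgroup.mem_sup_right (Subgroup.mem_closure_singleton_self x))
  have hninj : ¬ Function.Injective φ := by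
    intro hinj
    obtain ⟨u, hu⟩ := hβ ⟨x, hxC⟩
    have h1 : φ u = 1 := by
      change ρ (β u) = 1
      rw [hu]
      exact hπ2 _ rfl
    have h2 : u = 1 := hinj (by rw [h1, map_one])
    apply hx
    rw [h2, map_one] at hu
    exact (congrArg Subtype.val hu).symm
  obtain ⟨T, hT, hTc⟩ := aux_rank_lt φ.range φ rfl hninj
  have hB₀D : B₀ ≤ φ.range := by
    intro g hg
    obtain ⟨u, hu⟩ := hβ ⟨g, hBC (Subgroup.mem_sup_left hg)⟩
    refine ⟨u, ?_⟩
    change ρ (β u) = g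
    rw [hu]
    exact hπ1 _ (hB₀2 hg)
  have hDB : φ.range ≤ B := by
    have hG : ∀ g (hg : g ∈ B₁ ⊔ Subgroup.closure {x}),
        π ⟨g, sup_le_sup_right hB₁2 _ hg⟩ ∈ B := by
      have hle : B₁ ⊔ Subgroup.closure {x} ≤
          (B.comap π).map (A₂ ⊔ Subgroup.closure {x}).subtype := by
        refine sup_le ?_ ?_
        · intro g hg
          refine ⟨⟨g, Subgroup.mem_sup_left (hB₁2 hg)⟩, ?_, rfl⟩
          change π _ ∈ B
          rw [hπ1 _ (hB₁2 hg)]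
          exact hB₁ hg
        · rw [Subgroup.closure_le, Set.singleton_subset_iff]
          refine ⟨⟨x, Subgroup.mem_sup_right (Subgroup.mem_closure_singleton_self x)⟩, ?_, rfl⟩
          change π _ ∈ B
          rw [hπ2 _ rfl]
          exact one_mem B
      intro g hg
      obtain ⟨y, hy, rfl⟩ := hle hg
      exact hy
    rintro _ ⟨u, rfl⟩
    exact hG _ (hCB₁ (β u).2)
  have := hmin φ.range hDB hB₀D T.card (aux_rank_le_s6.2 ⟨T, le_rfl, hTc⟩)
  simp at hT
  omega

/-- If `localRank B < ∞`, `B ≤ A` and `A` is strongly closable, then every `B`-admissible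
sequence in `Γ` is also `A`-admissible. -/
theorem admissibleSeq_mono {Γ : Type*} [Group Γ] (A B : Subgroup Γ)
    (hB : localRank B < ⊤) (hBA : B ≤ A) (hA : StronglyClosable A)
    (l : List Γ) (hl : l ≠ []) (h : AdmissibleSeq B l) : AdmissibleSeq A l := by
  clear hl
  induction l generalizing A B with
  | nil => trivial
  | cons x xs ih =>
    obtain ⟨h1, h2⟩ := h
    have h3 := aux_step_s6 A B hB hBA hA x h1
    exact ⟨h3, ih _ _ (lt_of_lt_of_le h1.1 le_top) (sup_le_sup_right hBA _) h3.1 h2⟩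
end
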